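/- arXiv:2307.16306 — 3 statements merged into one kernel-verified Lean document; each statement's English description precedes it below -/
import Mathlib

section
/- For every positive integer d there exist, up to unimodular equivalence, only finitely many d-dimensional sporadic F-hollow lattice polytopes; i.e., there is a finite list P₁, …, P_N of d-dimensional lattice polytopes in ℝ^d such that every d-dimensional sporadic F-hollow lattice polytope is unimodular equivalent to some P_i. -/
open Set MeasureTheory

noncomputable section

/-- The real vector corresponding to an integer vector. -/
def intVec {d : ℕ} (ν : Fin d → ℤ) : Fin d → ℝ := fun i => (ν i : ℝ)

/-- The standard inner product on `ℝ^d`. -/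
def dotR {d : ℕ} (x y : Fin d → ℝ) : ℝ := ∑ i, x i * y i

/-- `Min_P(ν) = min_{x ∈ P} ⟨x, ν⟩`. -/
def MinP {d : ℕ} (P : Set (Fin d → ℝ)) (ν : Fin d → ℝ) : ℝ :=
  sInf ((fun x => dotR x ν) '' P)

/-- The set of lattice points of `ℝ^d`. -/
def latticePts (d : ℕ) : Set (Fin d → ℝ) := Set.range intVec

/-- The set of rational points of `ℝ^d`. -/
def ratPts (d : ℕ) : Set (Fin d → ℝ) := {x | ∀ i, ∃ q : ℚ, x i = (q : ℝ)}

/-- The Fine interior of `P`. -/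
def fineInt {d : ℕ} (P : Set (Fin d → ℝ)) : Set (Fin d → ℝ) :=
  {x | ∀ ν : Fin d → ℤ, ν ≠ 0 → MinP P (intVec ν) + 1 ≤ dotR x (intVec ν)}

/-- A lattice polytope: the convex hull of a finite set of lattice points. -/
def IsLatticePolytope {d : ℕ} (P : Set (Fin d → ℝ)) : Prop :=
  ∃ A : Finset (Fin d → ℝ), ↑A ⊆ latticePts d ∧ P = convexHull ℝ (A : Set (Fin d → ℝ))

/-- A rational polytope: the convex hull of a finite set of rational points. -/
def IsRatPolytope {d : ℕ} (P : Set (Fin d → ℝ)) : Prop :=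
  ∃ A : Finset (Fin d → ℝ), ↑A ⊆ ratPts d ∧ P = convexHull ℝ (A : Set (Fin d → ℝ))

/-- A subset of `ℝ^d` is full-dimensional if its affine span is everything. -/
def IsFullDim {d : ℕ} (P : Set (Fin d → ℝ)) : Prop := affineSpan ℝ P = ⊤

/-- `P` is F-hollow if its Fine interior is empty. -/
def FHollow {d : ℕ} (P : Set (Fin d → ℝ)) : Prop := fineInt P = ∅

/-- The dilation `λP = {λx : x ∈ P}`. -/
def dilate {d : ℕ} (lam : ℝ) (P : Set (Fin d → ℝ)) : Set (Fin d → ℝ) :=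
  (fun x => lam • x) '' P

/-- The minimal multiplier `μ(P)`. -/
def minMult {d : ℕ} (P : Set (Fin d → ℝ)) : ℝ :=
  sInf {lam : ℝ | 0 < lam ∧ (fineInt (dilate lam P)).Nonempty}

/-- Unimodular equivalence of subsets of `ℝ^d`. -/
def UnimodEquiv {d : ℕ} (P₁ P₂ : Set (Fin d → ℝ)) : Prop :=
  ∃ φ : (Fin d → ℝ) ≃ᵃ[ℝ] (Fin d → ℝ),
    φ '' latticePts d = latticePts d ∧ φ '' P₁ = P₂

/-- An affine map `ℝ^d → ℝ^k` inducing a surjection of lattices. -/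
def IsLatticeProj {d k : ℕ} (π : (Fin d → ℝ) →ᵃ[ℝ] (Fin k → ℝ)) : Prop :=
  π '' latticePts d = latticePts k

/-- A sporadic F-hollow lattice polytope: a full-dimensional F-hollow lattice
polytope admitting no lattice projection onto a lower-dimensional F-hollow
lattice polytope. -/
def IsSporadic {d : ℕ} (P : Set (Fin d → ℝ)) : Prop :=
  IsLatticePolytope P ∧ IsFullDim P ∧ FHollow P ∧
  ¬ ∃ (k : ℕ) (_ : 1 ≤ k) (_ : k ≤ d - 1) (π : (Fin d → ℝ) →ᵃ[ℝ] (Fin k → ℝ)),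
      IsLatticeProj π ∧ IsLatticePolytope (π '' P) ∧ IsFullDim (π '' P) ∧
      FHollow (π '' P)

/-- A weakly sporadic F-hollow lattice polytope: a full-dimensional F-hollow
lattice polytope `P` such that `F(μ(P)·P)` is a single point. -/
def IsWeaklySporadic {d : ℕ} (P : Set (Fin d → ℝ)) : Prop :=
  IsLatticePolytope P ∧ IsFullDim P ∧ FHollow P ∧
  ∃ p : Fin d → ℝ, fineInt (dilate (minMult P) P) = {p}

/-- The support `S_F(P)` of the Fine interior of `P`. -/
def suppF {d : ℕ} (P : Set (Fin d → ℝ)) : Set (Fin d → ℤ) :=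
  {ν | MinP (fineInt P) (intVec ν) = MinP P (intVec ν) + 1}

/-- The dimension of the affine span of a set. -/
def aDim {d : ℕ} (S : Set (Fin d → ℝ)) : ℕ :=
  Module.finrank ℝ (affineSpan ℝ S).direction

/-- Lebesgue volume of a subset of `ℝ^d`, as a real number. -/
def vol {d : ℕ} (S : Set (Fin d → ℝ)) : ℝ := (volume S).toReal

section

/-- Simultaneous Dirichlet approximation. -/
theorem exists_simultaneous_approx {ι : Type*} [Fintype ι] (x : ι → ℝ) {δ : ℝ} (hδ : 0 < δ) :
    ∃ q : ℕ, 0 < q ∧ ∃ p : ι → ℤ, ∀ i, |(q : ℝ) * x i - p i| < δ := by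
  classical
  obtain ⟨M, hM⟩ := exists_nat_gt (1 / δ)
  have hM0 : (0 : ℝ) < M := lt_trans (by positivity) hM
  have hMpos : 0 < M := by exact_mod_cast hM0
  have key (k : ℕ) (i : ι) : ⌊(M : ℝ) * Int.fract (k * x i)⌋₊ < M := by
    rw [Nat.floor_lt (by have := Int.fract_nonneg (k * x i); positivity)]
    nlinarith [Int.fract_lt_one (k * x i)]
  obtain ⟨k, l, hkl, heq⟩ := Finite.exists_ne_map_eq_of_infinite
    (fun (k : ℕ) (i : ι) => (⟨⌊(M : ℝ) * Int.fract (k * x i)⌋₊, key k i⟩ : Fin M))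
  wlog hlt : k < l generalizing k l
  · exact this l k hkl.symm heq.symm (by omega)
  refine ⟨l - k, by omega, fun i => ⌊l * x i⌋ - ⌊k * x i⌋, fun i => ?_⟩
  have h1 : ⌊(M : ℝ) * Int.fract (k * x i)⌋₊ = ⌊(M : ℝ) * Int.fract (l * x i)⌋₊ := by
    have := congrFun heq i
    simpa using this
  have hk0 : (0 : ℝ) ≤ M * Int.fract (k * x i) := by
    have := Int.fract_nonneg (k * x i); positivity
  have hl0 : (0 : ℝ) ≤ M * Int.fract (l * x i) := by
    have := Int.fract_nonneg (l * x i); positivity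
  have hk1 := Nat.floor_le hk0
  have hk2 := Nat.lt_floor_add_one ((M : ℝ) * Int.fract (k * x i))
  have hl1 := Nat.floor_le hl0
  have hl2 := Nat.lt_floor_add_one ((M : ℝ) * Int.fract (l * x i))
  rw [h1] at hk1 hk2
  have hMδ : 1 < M * δ := by rwa [div_lt_iff₀ hδ] at hM
  have e : ((l - k : ℕ) : ℝ) * x i - ((⌊l * x i⌋ - ⌊k * x i⌋ : ℤ) : ℝ) =
      Int.fract (l * x i) - Int.fract (k * x i) := by
    rw [Nat.cast_sub hlt.le, Int.fract, Int.fract]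
    push_cast
    ring
  rw [e, abs_lt]
  constructor <;> nlinarith

/-- A probability vector has a positive multiple that slightly dominates a nonzero natural
vector on its support. -/
theorem exists_multiple_near_nat {ι : Type*} [Fintype ι] (x : ι → ℝ) (hx : ∀ i, 0 ≤ x i)
    (hsum : ∑ i, x i = 1) :
    ∃ (s : ℝ) (n : ι → ℕ), 0 < s ∧ 0 < ∑ i, n i ∧
      (∀ i, (x i = 0 → n i = 0) ∧ (0 < x i → (n i : ℝ) < s * x i)) ∧
      s - ∑ i, (n i : ℝ) < 1 / 2 := by
  classical
  obtain ⟨m, hm0, hm⟩ : ∃ m : ℝ, 0 < m ∧ ∀ i, 0 < x i → m ≤ x i := by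
    by_cases hne : (Finset.univ.filter fun i => 0 < x i).Nonempty
    · obtain ⟨j, hj, hmin⟩ := Finset.exists_min_image _ x hne
      exact ⟨x j, by simpa using hj, fun i hi => hmin i (by simpa using hi)⟩
    · refine ⟨1, one_pos, fun i hi => absurd ⟨i, by simpa using hi⟩ hne⟩
  set r : ℝ := ((Fintype.card ι : ℕ) : ℝ) with hr
  have hr0 : 0 ≤ r := by positivity
  set δ : ℝ := min (m / 8) (1 / (8 * (r + 1))) with hδ
  have hδ0 : 0 < δ := lt_min (by positivity) (by positivity)
  have hδm : δ ≤ m / 8 := min_le_left _ _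
  have hδr : δ * (8 * (r + 1)) ≤ 1 := by
    have := min_le_right (m / 8) (1 / (8 * (r + 1)))
    rwa [← hδ, le_div_iff₀ (by positivity)] at this
  have hδ1 : δ < 1 := by nlinarith
  obtain ⟨q, hq, p, hp⟩ := exists_simultaneous_approx x hδ0
  have hq1 : (1 : ℝ) ≤ q := by exact_mod_cast hq
  have hp0 (i : ι) : 0 ≤ p i := by
    have h1 := (abs_lt.1 (hp i)).2
    have h2 : (-1 : ℝ) < p i := by nlinarith [hx i]
    have : (-1 : ℤ) < p i := by exact_mod_cast h2
    omega
  have hcast (i : ι) : (((p i).toNat : ℕ) : ℝ) = p i := by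
    have := Int.toNat_of_nonneg (hp0 i)
    exact_mod_cast this
  have hbound : (q : ℝ) - ∑ i, (p i : ℝ) ≤ r * δ := by
    calc (q : ℝ) - ∑ i, (p i : ℝ) = ∑ i, (q * x i - p i) := by
          rw [Finset.sum_sub_distrib, ← Finset.mul_sum, hsum, mul_one]
      _ ≤ ∑ i : ι, δ := Finset.sum_le_sum fun i _ => (abs_lt.1 (hp i)).2.le
      _ = r * δ := by simp [hr]
  have hlast : (q : ℝ) + 1 / 8 - ∑ i, (((p i).toNat : ℕ) : ℝ) < 1 / 2 := by
    simp only [hcast]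
    nlinarith
  refine ⟨q + 1 / 8, fun i => (p i).toNat, by positivity, ?_, fun i => ⟨fun h => ?_, fun h => ?_⟩,
    hlast⟩
  · have : (0 : ℝ) < ∑ i, (((p i).toNat : ℕ) : ℝ) := by linarith
    exact_mod_cast this
  · have h1 := (abs_lt.1 (hp i)).1
    rw [h] at h1
    have h2 : (p i : ℝ) < 1 := by linarith
    have : p i < 1 := by exact_mod_cast h2
    simp only
    omega
  · rw [hcast]
    have h1 := (abs_lt.1 (hp i)).1
    have := hm i h
    nlinarith

/-- A probability vector of given length either has all entries bounded below by a uniform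
constant, or some multiple of it, of uniformly bounded size, slightly dominates a nonzero natural
vector having a zero entry. -/
theorem exists_uniform_bound_or_near_nat (r : ℕ) :
    ∃ q : ℕ, ∀ x : Fin r → ℝ, (∀ i, 0 ≤ x i) → ∑ i, x i = 1 →
      (∀ i, 1 / ((q : ℝ) + 1) < x i) ∨
      ∃ (s : ℝ) (n : Fin r → ℕ), 0 < s ∧ s ≤ q ∧ 0 < ∑ i, n i ∧ (∃ i, n i = 0) ∧
        (∀ i, (n i : ℝ) ≤ s * x i) ∧ s - ∑ i, (n i : ℝ) < 1 / 2 := by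
  let Q (s : ℝ) (n : Fin r → ℕ) : Prop :=
    0 < s ∧ 0 < ∑ i, n i ∧ (∃ i, n i = 0) ∧ s - ∑ i, (n i : ℝ) < 1 / 2
  let U : ℕ → Set (Fin r → ℝ) := fun q =>
    {x | ∀ i, 1 / ((q : ℝ) + 1) < x i} ∪
      ⋃ (s : ℝ) (n : Fin r → ℕ) (_ : Q s n ∧ s ≤ q), {x | ∀ i, n i = 0 ∨ (n i : ℝ) < s * x i}
  have hUo : ∀ q, IsOpen (U q) := fun q => by
    refine IsOpen.union ?_ (isOpen_iUnion fun s => isOpen_iUnion fun n => isOpen_iUnion fun _ => ?_)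
    · rw [ofPred_forall]
      exact isOpen_iInter_of_finite fun i => isOpen_lt continuous_const (continuous_apply i)
    · rw [ofPred_forall]
      refine isOpen_iInter_of_finite fun i => ?_
      rw [ofPred_or]
      exact isOpen_const.union
        (isOpen_lt continuous_const (continuous_const.mul (continuous_apply i)))
  have hmono : Monotone U := by
    intro a b hab x hx
    have hab' : (a : ℝ) ≤ b := by exact_mod_cast hab
    rcases hx with hx | hx
    · refine Or.inl fun i => lt_of_le_of_lt ?_ (hx i)
      gcongr
    · right
      simp only [mem_iUnion] at hx ⊢
      obtain ⟨s, n, h, hx⟩ := hx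
      exact ⟨s, n, ⟨h.1, h.2.trans hab'⟩, hx⟩
  have hcover : stdSimplex ℝ (Fin r) ⊆ ⋃ q, U q := by
    intro x hx
    rw [mem_iUnion]
    by_cases hpos : ∀ i, 0 < x i
    · obtain ⟨m, hm0, hm⟩ : ∃ m : ℝ, 0 < m ∧ ∀ i, m ≤ x i := by
        rcases isEmpty_or_nonempty (Fin r) with h | h
        · exact ⟨1, one_pos, fun i => h.elim i⟩
        · obtain ⟨j, hj⟩ := Finite.exists_min x
          exact ⟨x j, hpos j, hj⟩
      obtain ⟨q, hq⟩ := exists_nat_one_div_lt hm0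
      exact ⟨q, Or.inl fun i => hq.trans_le (hm i)⟩
    · push Not at hpos
      obtain ⟨j, hj⟩ := hpos
      obtain ⟨s, n, hs, hn, h, hsn⟩ := exists_multiple_near_nat x hx.1 hx.2
      obtain ⟨q, hq⟩ := exists_nat_gt s
      refine ⟨q, Or.inr ?_⟩
      simp only [mem_iUnion]
      refine ⟨s, n, ⟨⟨hs, hn, ⟨j, (h j).1 (le_antisymm hj (hx.1 j))⟩, hsn⟩, hq.le⟩, fun i => ?_⟩
      rcases (hx.1 i).eq_or_lt with h0 | h0
      · exact Or.inl ((h i).1 h0.symm)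
      · exact Or.inr ((h i).2 h0)
  obtain ⟨q, hq⟩ := (isCompact_stdSimplex ℝ (Fin r)).elim_directed_cover U hUo hcover
    hmono.directed_le
  refine ⟨q, fun x hx hsum => ?_⟩
  rcases hq ⟨hx, hsum⟩ with h | h
  · exact Or.inl h
  · right
    simp only [mem_iUnion] at h
    obtain ⟨s, n, ⟨⟨hs, hn, hz, hsn⟩, hsq⟩, h⟩ := h
    refine ⟨s, n, hs, hsq, hn, hz, fun i => ?_, hsn⟩
    rcases h i with h0 | h0
    · rw [h0]
      have := hx i
      push_cast
      positivity
    · exact h0.le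

variable {d : ℕ}

theorem dotR_intVec (x y : Fin d → ℤ) : dotR (intVec x) (intVec y) = ((x ⬝ᵥ y : ℤ) : ℝ) := by
  simp [dotR, intVec, dotProduct]

theorem continuous_dotR (ν : Fin d → ℝ) : Continuous fun x : Fin d → ℝ => dotR x ν := by
  unfold dotR
  fun_prop

theorem minP_le {P : Set (Fin d → ℝ)} (hP : IsCompact P) (ν : Fin d → ℝ) {x : Fin d → ℝ}
    (hx : x ∈ P) : MinP P ν ≤ dotR x ν :=
  csInf_le (hP.image (continuous_dotR ν)).bddBelow ⟨x, hx, rfl⟩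

theorem le_minP {P : Set (Fin d → ℝ)} (hP : P.Nonempty) {ν : Fin d → ℝ} {t : ℝ}
    (h : ∀ x ∈ P, t ≤ dotR x ν) : t ≤ MinP P ν := by
  refine le_csInf (hP.image _) ?_
  rintro _ ⟨x, hx, rfl⟩
  exact h x hx

theorem dotR_sum_right {ι : Type*} (s : Finset ι) (x : Fin d → ℝ) (w : ι → ℝ)
    (ν : ι → Fin d → ℝ) (y : Fin d → ℝ) (h : ∀ k, ∑ i ∈ s, w i * ν i k = y k) :
    ∑ i ∈ s, w i * dotR x (ν i) = dotR x y := by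
  simp only [dotR, Finset.mul_sum]
  rw [Finset.sum_comm]
  refine Finset.sum_congr rfl fun k _ => ?_
  rw [← h k, Finset.mul_sum]
  exact Finset.sum_congr rfl fun i _ => by ring

/-- The weights `w` on the nonzero integral covectors `ν` witness that moving every supporting
halfspace of `P` inwards by more than `c` leaves the empty set. -/
def IsCert {ι : Type*} [Fintype ι] (P : Set (Fin d → ℝ)) (c : ℝ) (ν : ι → Fin d → ℤ)
    (w : ι → ℝ) : Prop :=
  (∀ i, ν i ≠ 0) ∧ (∀ i, 0 ≤ w i) ∧ 0 < ∑ i, w i ∧ (∀ k, ∑ i, w i * (ν i k : ℝ) = 0) ∧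
    0 ≤ ∑ i, w i * (MinP P (intVec (ν i)) + c)

theorem IsCert.comp_equiv {ι κ : Type*} [Fintype ι] [Fintype κ] {P : Set (Fin d → ℝ)} {c : ℝ}
    {ν : ι → Fin d → ℤ} {w : ι → ℝ} (h : IsCert P c ν w) (e : κ ≃ ι) :
    IsCert P c (ν ∘ e) (w ∘ e) := by
  obtain ⟨h1, h2, h3, h4, h5⟩ := h
  refine ⟨fun i => h1 _, fun i => h2 _, ?_, fun k => ?_, ?_⟩
  · simpa only [Function.comp, e.sum_comp w] using h3
  · simpa only [Function.comp, e.sum_comp fun i => w i * (ν i k : ℝ)] using h4 k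
  · simpa only [Function.comp, e.sum_comp fun i => w i * (MinP P (intVec (ν i)) + c)] using h5

/-- The weighted covectors of a certificate sum to zero. -/
theorem IsCert.sum_dotR {ι : Type*} [Fintype ι] {P : Set (Fin d → ℝ)} {c : ℝ}
    {ν : ι → Fin d → ℤ} {w : ι → ℝ} (h : IsCert P c ν w) (x : Fin d → ℝ) :
    ∑ i, w i * dotR x (intVec (ν i)) = 0 := by
  rw [dotR_sum_right Finset.univ x w (fun i => intVec (ν i)) 0 fun k => by
    simpa [intVec] using h.2.2.2.1 k]
  simp [dotR]

/-- A form of Farkas' lemma. -/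
theorem exists_weights_of_infeasible {ι : Type*} [Fintype ι] (ν : ι → Fin d → ℝ) (b : ι → ℝ)
    (h : ∀ x : Fin d → ℝ, ∃ i, dotR x (ν i) < b i) :
    ∃ w : ι → ℝ, (∀ i, 0 ≤ w i) ∧ ∑ i, w i = 1 ∧ (∀ k, ∑ i, w i * ν i k = 0) ∧
      0 ≤ ∑ i, w i * b i := by
  classical
  let Φ : (ι → ℝ) →ₗ[ℝ] (Fin d → ℝ) × ℝ :=
    { toFun := fun w => (fun k => ∑ i, w i * ν i k, ∑ i, w i * b i)
      map_add' := fun v w => by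
        ext <;> simp [add_mul, Finset.sum_add_distrib]
      map_smul' := fun r w => by
        ext <;> simp [Finset.mul_sum, mul_assoc] }
  have hΦ : Continuous Φ := Φ.continuous_of_finiteDimensional
  let R : Set ((Fin d → ℝ) × ℝ) := {0} ×ˢ Ici 0
  by_cases hdis : Disjoint (Φ '' stdSimplex ℝ ι) R
  · exfalso
    obtain ⟨f, u, v, h1, huv, h2⟩ := geometric_hahn_banach_compact_closed
      ((convex_stdSimplex ℝ ι).linear_image Φ) ((isCompact_stdSimplex ℝ ι).image hΦ)
      ((convex_singleton _).prod (convex_Ici _)) (isClosed_singleton.prod isClosed_Ici) hdis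
    set s : ℝ := f (0, 1) with hs
    let g : Fin d → ℝ := fun k => f (Pi.single k 1, 0)
    have hf (y : Fin d → ℝ) (t : ℝ) : f (y, t) = dotR g y + t * s := by
      have e1 : (y, t) = ∑ k, y k • ((Pi.single k 1 : Fin d → ℝ), (0 : ℝ)) + t • (0, 1) := by
        ext k
        · simp [Finset.sum_apply, Pi.single_apply, Prod.fst_sum]
        · simp [Prod.snd_sum]
      rw [e1, map_add, map_sum, map_smul, smul_eq_mul]
      simp only [map_smul, smul_eq_mul, dotR, g]
      congr 1
      exact Finset.sum_congr rfl fun k _ => mul_comm _ _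
    have hpt (i : ι) : dotR g (ν i) + b i * s < u := by
      have := h1 _ ⟨Pi.single i 1, single_mem_stdSimplex ℝ i, rfl⟩
      have e : Φ (Pi.single i 1) = (ν i, b i) := by
        ext <;> simp [Φ, Pi.single_apply]
      rwa [e, hf] at this
    have hray (t : ℝ) (ht : 0 ≤ t) : v < t * s := by
      have := h2 (0, t) ⟨rfl, ht⟩
      rw [hf] at this
      simpa [dotR] using this
    have hv : v < 0 := by simpa using hray 0 le_rfl
    have hs0 : 0 ≤ s := by
      by_contra hneg
      push Not at hneg
      have := hray (v / s) (div_nonneg_of_nonpos hv.le hneg.le)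
      rw [div_mul_cancel₀ _ hneg.ne] at this
      exact lt_irrefl _ this
    have hsmul (T : ℝ) (y : Fin d → ℝ) : dotR (T • g) y = T * dotR g y := by
      simp [dotR, Finset.mul_sum, mul_assoc]
    rcases hs0.eq_or_lt with hs0 | hs0
    · have hneg (i : ι) : dotR g (ν i) < 0 := by
        have := hpt i
        rw [← hs0] at this
        linarith
      obtain ⟨T, hT⟩ : ∃ T : ℝ, ∀ i, b i / dotR g (ν i) ≥ T := by
        obtain ⟨T, hT⟩ := (finite_range fun i => b i / dotR g (ν i)).bddBelow
        exact ⟨T, fun i => hT ⟨i, rfl⟩⟩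
      obtain ⟨i, hi⟩ := h (T • g)
      rw [hsmul] at hi
      have h3 := hT i
      rw [ge_iff_le, le_div_iff_of_neg (hneg i)] at h3
      linarith
    · obtain ⟨i, hi⟩ := h ((-1 / s) • g)
      rw [hsmul] at hi
      have h3 := hpt i
      have h4 : (-1 / s * dotR g (ν i)) * s = - dotR g (ν i) := by field_simp
      have := mul_lt_mul_of_pos_right hi hs0
      linarith
  · obtain ⟨_, ⟨w, hw, rfl⟩, hw2⟩ := not_disjoint_iff.1 hdis
    refine ⟨w, hw.1, hw.2, fun k => ?_, hw2.2⟩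
    exact congrFun (show (Φ w).1 = 0 from hw2.1) k

/-- An F-hollow polytope has a certificate with constant less than one. -/
theorem FHollow.exists_isCert {P : Set (Fin d → ℝ)} (hP : FHollow P) :
    ∃ c < 1, ∃ (r : ℕ) (ν : Fin r → Fin d → ℤ) (w : Fin r → ℝ), IsCert P c ν w := by
  classical
  let I := {ν : Fin d → ℤ // ν ≠ 0} × ℕ
  let Z : I → Set (Fin d → ℝ) := fun i =>
    {x | MinP P (intVec i.1.1) + 1 - 1 / ((i.2 : ℝ) + 1) ≤ dotR x (intVec i.1.1)}
  have hne (k : Fin d) : (Pi.single k 1 : Fin d → ℤ) ≠ 0 := by simp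
  have hne' (k : Fin d) : (-Pi.single k 1 : Fin d → ℤ) ≠ 0 := by simp
  have hdot (x : Fin d → ℝ) (k : Fin d) : dotR x (intVec (Pi.single k 1)) = x k := by
    simp [dotR, intVec, Pi.single_apply]
  have hdot' (x : Fin d → ℝ) (k : Fin d) : dotR x (intVec (-Pi.single k 1)) = - x k := by
    simp [dotR, intVec, Pi.single_apply]
  let K : Set (Fin d → ℝ) := Icc (fun k => MinP P (intVec (Pi.single k 1)))
    (fun k => - MinP P (intVec (-Pi.single k 1)))
  obtain ⟨t, ht⟩ := (isCompact_Icc : IsCompact K).elim_finite_subfamily_closed Z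
    (fun i => isClosed_le continuous_const (continuous_dotR _)) (by
      rw [eq_empty_iff_forall_notMem]
      rintro x ⟨-, hx⟩
      rw [mem_iInter] at hx
      have : x ∈ fineInt P := by
        intro ν hν
        refine le_of_forall_pos_lt_add fun ε hε => ?_
        obtain ⟨n, hn⟩ := exists_nat_one_div_lt hε
        have := hx ⟨⟨ν, hν⟩, n⟩
        simp only [Z, Set.mem_ofPred_eq] at this
        linarith
      rw [hP] at this
      exact this)
  let t' : Finset I := t ∪ Finset.univ.image (fun k => (⟨_, hne k⟩, 0)) ∪
    Finset.univ.image (fun k => (⟨_, hne' k⟩, 0))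
  obtain ⟨N, hN⟩ : ∃ N : ℕ, ∀ i ∈ t', i.2 ≤ N :=
    ⟨t'.sup Prod.snd, fun i hi => Finset.le_sup (f := Prod.snd) hi⟩
  have hinf (x : Fin d → ℝ) : ∃ i : t', dotR x (intVec i.1.1.1) <
      MinP P (intVec i.1.1.1) + (1 - 1 / ((N : ℝ) + 1)) := by
    by_contra! hcon
    have hx : ∀ i ∈ t', x ∈ Z i := by
      intro i hi
      have h1 := hcon ⟨i, hi⟩
      have h2 : (i.2 : ℝ) ≤ N := by exact_mod_cast hN i hi
      have h3 : 1 / ((N : ℝ) + 1) ≤ 1 / ((i.2 : ℝ) + 1) := by gcongr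
      simp only [Z, Set.mem_ofPred_eq]
      linarith
    have hxK : x ∈ K := by
      constructor
      · intro k
        have := hx (⟨_, hne k⟩, 0) (by simp [t'])
        simp only [Z, Set.mem_ofPred_eq, hdot] at this
        simpa using this
      · intro k
        have := hx (⟨_, hne' k⟩, 0) (by simp [t'])
        simp only [Z, Set.mem_ofPred_eq, hdot'] at this
        simp only [Nat.cast_zero] at this
        simp only
        linarith
    have : x ∈ K ∩ ⋂ i ∈ t, Z i :=
      ⟨hxK, mem_iInter₂.2 fun i hi => hx i (by simp [t', hi])⟩
    rw [ht] at this
    exact this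
  obtain ⟨w, h1, h2, h3, h4⟩ := exists_weights_of_infeasible
    (fun i : t' => intVec i.1.1.1) _ hinf
  have hc : IsCert P (1 - 1 / ((N : ℝ) + 1)) (fun i : t' => i.1.1.1) w :=
    ⟨fun i => i.1.1.2, h1, by rw [h2]; exact one_pos, h3, h4⟩
  refine ⟨1 - 1 / ((N : ℝ) + 1), ?_, _, _, _, hc.comp_equiv (Fintype.equivFin t').symm⟩
  have : (0 : ℝ) < 1 / ((N : ℝ) + 1) := by positivity
  linarith

theorem IsCert.smul {ι : Type*} [Fintype ι] {P : Set (Fin d → ℝ)} {c : ℝ}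
    {ν : ι → Fin d → ℤ} {w : ι → ℝ} (h : IsCert P c ν w) {t : ℝ} (ht : 0 < t) :
    IsCert P c ν (t • w) := by
  obtain ⟨h1, h2, h3, h4, h5⟩ := h
  refine ⟨h1, fun i => mul_nonneg ht.le (h2 i), ?_, fun k => ?_, ?_⟩
  · simp only [Pi.smul_apply, smul_eq_mul, ← Finset.mul_sum]
    positivity
  · simp only [Pi.smul_apply, smul_eq_mul, mul_assoc, ← Finset.mul_sum, h4, mul_zero]
  · simp only [Pi.smul_apply, smul_eq_mul, mul_assoc, ← Finset.mul_sum]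
    positivity

theorem IsCert.remove_zero {r : ℕ} {P : Set (Fin d → ℝ)} {c : ℝ}
    {ν : Fin (r + 1) → Fin d → ℤ} {w : Fin (r + 1) → ℝ} (h : IsCert P c ν w) {i : Fin (r + 1)}
    (hi : w i = 0) : IsCert P c (ν ∘ i.succAbove) (w ∘ i.succAbove) := by
  obtain ⟨h1, h2, h3, h4, h5⟩ := h
  rw [Fin.sum_univ_succAbove _ i, hi] at h3 h5
  refine ⟨fun i => h1 _, fun i => h2 _, by simpa using h3, fun k => ?_, by simpa using h5⟩
  have := h4 k
  rw [Fin.sum_univ_succAbove _ i, hi] at this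
  simpa using this

/-- In the plane spanned by a positive vector `w` and another vector `u`, there is a nonzero
nonnegative vector with a zero entry in any halfspace containing `w`. -/
theorem exists_nonneg_combination_with_zero {ι : Type*} [Fintype ι] [Nonempty ι] {w u : ι → ℝ}
    (hw : ∀ i, 0 < w i) (hu : ∀ t : ℝ, u ≠ t • w) (φ : (ι → ℝ) →ₗ[ℝ] ℝ) (hφ : 0 ≤ φ w) :
    ∃ a b : ℝ, (∀ i, 0 ≤ (a • w + b • u) i) ∧ (∃ i, 0 < (a • w + b • u) i) ∧
      (∃ i, (a • w + b • u) i = 0) ∧ 0 ≤ φ (a • w + b • u) := by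
  obtain ⟨i₀, hi₀⟩ := Finite.exists_min fun i => u i / w i
  set α := u i₀ / w i₀ with hα
  set u₁ := (-α) • w + (1 : ℝ) • u with hu₁
  have happ (i : ι) : u₁ i = -α * w i + u i := by simp [hu₁]
  have hnn (i : ι) : 0 ≤ u₁ i := by
    have := hi₀ i
    rw [le_div_iff₀ (hw i)] at this
    rw [happ]
    linarith
  have hz : u₁ i₀ = 0 := by
    rw [happ, hα]
    have := (hw i₀).ne'
    field_simp
    ring
  have hpos : ∃ i, 0 < u₁ i := by
    by_contra! hcon
    refine hu α (funext fun i => ?_)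
    have := le_antisymm (hcon i) (hnn i)
    rw [happ] at this
    simp only [Pi.smul_apply, smul_eq_mul]
    linarith
  by_cases hφ₁ : 0 ≤ φ u₁
  · exact ⟨-α, 1, hnn, hpos, ⟨i₀, hz⟩, hφ₁⟩
  · push Not at hφ₁
    obtain ⟨i₁, hi₁⟩ := Finite.exists_max fun i => u₁ i / w i
    set M := u₁ i₁ / w i₁ with hM
    have hM0 : 0 < M := by
      obtain ⟨i, hi⟩ := hpos
      exact (div_pos hi (hw i)).trans_le (hi₁ i)
    have e : (1 + α / M) • w + (-1 / M) • u = w - (1 / M) • u₁ := by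
      ext i
      simp only [Pi.add_apply, Pi.sub_apply, Pi.smul_apply, smul_eq_mul, happ]
      ring
    refine ⟨1 + α / M, -1 / M, ?_, ?_, ?_, ?_⟩
    · intro i
      rw [e]
      have h1 := hi₁ i
      rw [div_le_iff₀ (hw i)] at h1
      have h2 : 1 / M * u₁ i ≤ w i := by
        rw [div_mul_eq_mul_div, one_mul, div_le_iff₀ hM0]
        linarith
      simpa using h2
    · refine ⟨i₀, ?_⟩
      rw [e]
      simpa [hz] using hw i₀
    · refine ⟨i₁, ?_⟩
      rw [e]
      have h1 := (hw i₁).ne'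
      have h2 : u₁ i₁ = M * w i₁ := by rw [hM]; field_simp
      have h3 := hM0.ne'
      simp only [Pi.sub_apply, Pi.smul_apply, smul_eq_mul, h2]
      field_simp
      ring
    · rw [e, map_sub, map_smul, smul_eq_mul]
      have : 1 / M * φ u₁ < 0 := mul_neg_of_pos_of_neg (by positivity) hφ₁
      linarith

/-- A certificate of minimal size has positive weights and a unique linear relation. -/
theorem exists_reduced_isCert {P : Set (Fin d → ℝ)} {c : ℝ}
    (h : ∃ (r : ℕ) (ν : Fin r → Fin d → ℤ) (w : Fin r → ℝ), IsCert P c ν w) :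
    ∃ (r : ℕ) (ν : Fin r → Fin d → ℤ) (w : Fin r → ℝ), IsCert P c ν w ∧ (∀ i, 0 < w i) ∧
      ∑ i, w i = 1 ∧
      ∀ u : Fin r → ℝ, (∀ k, ∑ i, u i * (ν i k : ℝ) = 0) → ∃ t : ℝ, u = t • w := by
  classical
  obtain ⟨ν, w, hc⟩ := Nat.find_spec h
  have hmin : ∀ m < Nat.find h, ¬ ∃ (ν : Fin m → Fin d → ℤ) (w : Fin m → ℝ), IsCert P c ν w :=
    fun m hm => Nat.find_min h hm
  generalize Nat.find h = r at ν w hc hmin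
  obtain _ | r := r
  · simpa using hc.2.2.1
  have hw (i : Fin (r + 1)) : 0 < w i := by
    by_contra hcon
    exact hmin r (by omega) ⟨_, _, hc.remove_zero (le_antisymm (not_lt.1 hcon) (hc.2.1 i))⟩
  have huniq (u : Fin (r + 1) → ℝ) (hu : ∀ k, ∑ i, u i * (ν i k : ℝ) = 0) :
      ∃ t : ℝ, u = t • w := by
    by_contra! hcon
    let φ : (Fin (r + 1) → ℝ) →ₗ[ℝ] ℝ :=
      { toFun := fun w => ∑ i, w i * (MinP P (intVec (ν i)) + c)
        map_add' := fun v w => by simp [add_mul, Finset.sum_add_distrib]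
        map_smul' := fun r w => by simp [Finset.mul_sum, mul_assoc] }
    obtain ⟨a, b, h1, ⟨j, hj⟩, ⟨i, hi⟩, h2⟩ :=
      exists_nonneg_combination_with_zero hw hcon φ hc.2.2.2.2
    have : IsCert P c ν (a • w + b • u) := by
      refine ⟨hc.1, h1, Finset.sum_pos' (fun i _ => h1 i) ⟨j, Finset.mem_univ _, hj⟩,
        fun k => ?_, h2⟩
      simp only [Pi.add_apply, Pi.smul_apply, smul_eq_mul, add_mul, Finset.sum_add_distrib,
        mul_assoc, ← Finset.mul_sum, hu k, hc.2.2.2.1 k]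
      ring
    exact hmin r (by omega) ⟨_, _, this.remove_zero hi⟩
  have hS := hc.2.2.1
  set S := ∑ i, w i with hSdef
  refine ⟨r + 1, ν, S⁻¹ • w, hc.smul (inv_pos.2 hS), fun i => ?_, ?_, fun u hu => ?_⟩
  · exact mul_pos (inv_pos.2 hS) (hw i)
  · simp only [Pi.smul_apply, smul_eq_mul, ← Finset.mul_sum]
    exact inv_mul_cancel₀ hS.ne'
  · obtain ⟨t, rfl⟩ := huniq u hu
    refine ⟨t * S, ?_⟩
    rw [smul_smul, mul_assoc, mul_inv_cancel₀ hS.ne', mul_one]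

/-- Using a natural vector `n` slightly below a multiple of the weights, a certificate can be
improved. -/
theorem IsCert.improve {r : ℕ} {P : Set (Fin d → ℝ)} (hP : IsCompact P) (hPne : P.Nonempty)
    {c : ℝ} {ν : Fin r → Fin d → ℤ} {w : Fin r → ℝ} (h : IsCert P c ν w) (hw1 : ∑ i, w i = 1)
    (hw : ∀ i, 0 < w i)
    (huniq : ∀ u : Fin r → ℝ, (∀ k, ∑ i, u i * (ν i k : ℝ) = 0) → ∃ t : ℝ, u = t • w)
    {s : ℝ} (hs : 0 < s) {n : Fin r → ℕ} (hn : 0 < ∑ i, n i) (hz : ∃ i, n i = 0)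
    (hle : ∀ i, (n i : ℝ) ≤ s * w i) :
    ∃ (r' : ℕ) (ν' : Fin r' → Fin d → ℤ) (w' : Fin r' → ℝ),
      IsCert P (s * c / (1 + ∑ i, (n i : ℝ))) ν' w' := by
  classical
  set W : ℝ := 1 + ∑ i, (n i : ℝ) with hW
  have hW0 : 0 < W := by positivity
  set μ : Fin d → ℤ := fun k => -∑ i, (n i : ℤ) * ν i k with hμ
  have hμ0 : μ ≠ 0 := by
    intro h0
    obtain ⟨t, ht⟩ := huniq (fun i => n i) fun k => by
      have : -∑ i, (n i : ℤ) * ν i k = 0 := congrFun h0 k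
      have : ∑ i, (n i : ℤ) * ν i k = 0 := by omega
      exact_mod_cast this
    obtain ⟨j, hj⟩ := hz
    have h1 := congrFun ht j
    simp only [hj, Pi.smul_apply, smul_eq_mul, Nat.cast_zero] at h1
    have ht0 : t = 0 := by
      rcases mul_eq_zero.1 h1.symm with h2 | h2
      · exact h2
      · exact absurd h2 (hw j).ne'
    have : ∑ i, n i = 0 := Finset.sum_eq_zero fun i _ => by
      have := congrFun ht i
      simpa [ht0] using this
    omega
  have hdot (x : Fin d → ℝ) :
      dotR x (intVec μ) = ∑ i, (s * w i - n i) * dotR x (intVec (ν i)) := by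
    refine (dotR_sum_right Finset.univ x (fun i => s * w i - n i) (fun i => intVec (ν i))
      (intVec μ) fun k => ?_).symm
    have h4 := h.2.2.2.1 k
    simp only [sub_mul, Finset.sum_sub_distrib, mul_assoc, ← Finset.mul_sum, intVec, h4, hμ]
    push_cast
    ring
  have hmin : ∑ i, (s * w i - n i) * MinP P (intVec (ν i)) ≤ MinP P (intVec μ) := by
    refine le_minP hPne fun x hx => ?_
    rw [hdot]
    exact Finset.sum_le_sum fun i _ =>
      mul_le_mul_of_nonneg_left (minP_le hP _ hx) (sub_nonneg.2 (hle i))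
  have hwm : -c ≤ ∑ i, w i * MinP P (intVec (ν i)) := by
    have := h.2.2.2.2
    simp only [mul_add, Finset.sum_add_distrib, ← Finset.sum_mul, hw1] at this
    linarith
  have hc : IsCert P (s * c / W) (fun o : Option (Fin r) => o.elim μ ν)
      (fun o => o.elim 1 fun i => (n i : ℝ)) := by
    refine ⟨?_, ?_, ?_, fun k => ?_, ?_⟩
    · rintro (_ | i)
      · exact hμ0
      · exact h.1 i
    · rintro (_ | i)
      · exact zero_le_one
      · exact Nat.cast_nonneg _
    · simp only [Fintype.sum_option, Option.elim]
      exact hW0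
    · simp only [Fintype.sum_option, Option.elim, hμ]
      push_cast
      ring
    · simp only [Fintype.sum_option, Option.elim, mul_add, Finset.sum_add_distrib,
        ← Finset.sum_mul]
      simp only [sub_mul, Finset.sum_sub_distrib, mul_assoc, ← Finset.mul_sum] at hmin
      have e : 1 * (s * c / W) + (∑ i, (n i : ℝ)) * (s * c / W) = s * c := by
        rw [← add_mul]
        field_simp
        rw [hW]
        ring
      have := mul_le_mul_of_nonneg_left hwm hs.le
      linarith
  exact ⟨_, _, _, hc.comp_equiv (Fintype.equivFin _).symm⟩

/-- The constant of a certificate of a full-dimensional lattice polytope is bounded below. -/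
theorem IsCert.one_div_card_le {ι : Type*} [Fintype ι] {A : Finset (Fin d → ℤ)}
    (hA : A.Nonempty) {P : Set (Fin d → ℝ)} (hP : IsCompact P) (hAP : ∀ a ∈ A, intVec a ∈ P)
    (hfull : ∀ ν : Fin d → ℤ, ν ≠ 0 → ∃ a ∈ A, ∃ b ∈ A, a ⬝ᵥ ν ≠ b ⬝ᵥ ν)
    {c : ℝ} {ν : ι → Fin d → ℤ} {w : ι → ℝ} (h : IsCert P c ν w) : 1 / (A.card : ℝ) ≤ c := by
  have hcard : (0 : ℝ) < A.card := by exact_mod_cast hA.card_pos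
  have key (i : ι) : A.card * MinP P (intVec (ν i)) + 1 ≤
      ∑ a ∈ A, dotR (intVec a) (intVec (ν i)) := by
    obtain ⟨a₀, ha₀, hmin⟩ := A.exists_min_image (fun a => a ⬝ᵥ ν i) hA
    have hex : ∃ a ∈ A, a₀ ⬝ᵥ ν i < a ⬝ᵥ ν i := by
      by_contra! hcon
      obtain ⟨a, ha, b, hb, hab⟩ := hfull _ (h.1 i)
      exact hab ((le_antisymm (hcon a ha) (hmin a ha)).trans
        (le_antisymm (hcon b hb) (hmin b hb)).symm)
    have h0 : 0 < ∑ a ∈ A, (a ⬝ᵥ ν i - a₀ ⬝ᵥ ν i) := by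
      obtain ⟨a, ha, hlt⟩ := hex
      exact Finset.sum_pos' (fun a ha => sub_nonneg.2 (hmin a ha)) ⟨a, ha, sub_pos.2 hlt⟩
    rw [Finset.sum_sub_distrib, Finset.sum_const, nsmul_eq_mul] at h0
    have h1 : (A.card : ℤ) * (a₀ ⬝ᵥ ν i) + 1 ≤ ∑ a ∈ A, a ⬝ᵥ ν i := by linarith
    have h2 : (A.card : ℝ) * ((a₀ ⬝ᵥ ν i : ℤ) : ℝ) + 1 ≤ ∑ a ∈ A, ((a ⬝ᵥ ν i : ℤ) : ℝ) := by
      exact_mod_cast h1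
    simp only [dotR_intVec]
    have h3 := minP_le hP (intVec (ν i)) (hAP a₀ ha₀)
    rw [dotR_intVec] at h3
    have := mul_le_mul_of_nonneg_left h3 hcard.le
    linarith
  have hsum : ∑ i, w i * (A.card * MinP P (intVec (ν i)) + 1) ≤ 0 := by
    calc _ ≤ ∑ i, w i * ∑ a ∈ A, dotR (intVec a) (intVec (ν i)) :=
          Finset.sum_le_sum fun i _ => mul_le_mul_of_nonneg_left (key i) (h.2.1 i)
      _ = ∑ a ∈ A, ∑ i, w i * dotR (intVec a) (intVec (ν i)) := by
          simp only [Finset.mul_sum]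
          exact Finset.sum_comm
      _ = 0 := Finset.sum_eq_zero fun a _ => h.sum_dotR _
  have h5 := h.2.2.2.2
  have h3 := h.2.2.1
  have e : ∑ i, w i * (A.card * MinP P (intVec (ν i)) + 1) =
      A.card * ∑ i, w i * (MinP P (intVec (ν i)) + c) - (A.card * c - 1) * ∑ i, w i := by
    rw [Finset.mul_sum, Finset.mul_sum, ← Finset.sum_sub_distrib]
    exact Finset.sum_congr rfl fun i _ => by ring
  rw [e] at hsum
  rw [div_le_iff₀ hcard]
  by_contra! hcon
  have h6 : (A.card * c - 1) * ∑ i, w i < 0 := mul_neg_of_neg_of_pos (by linarith) h3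
  have := mul_nonneg hcard.le h5
  linarith

theorem exists_dotProduct_eq (φ : (Fin d → ℤ) →ₗ[ℤ] ℤ) :
    ∃ x : Fin d → ℤ, ∀ v, v ⬝ᵥ x = φ v := by
  classical
  refine ⟨fun i => φ (Pi.single i 1), fun v => ?_⟩
  rw [LinearMap.pi_apply_eq_sum_univ φ v]
  simp only [dotProduct, smul_eq_mul]
  refine Finset.sum_congr rfl fun i _ => ?_
  congr 2
  ext j
  simp [Pi.single_apply, eq_comm]

/-- A sublattice of `ℤ^d` is contained in a primitive sublattice of smaller rank, or has finite
index. -/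
theorem le_primitive_span_or_isTorsion_quotient (N : Submodule ℤ (Fin d → ℤ)) :
    (∃ k < d, ∃ u : Fin k → Fin d → ℤ, N ≤ Submodule.span ℤ (range u) ∧
      (∀ y : Fin k → ℤ, ∃ x : Fin d → ℤ, ∀ i, x ⬝ᵥ u i = y i) ∧
      ∃ ν : Fin d → ℤ, ν ≠ 0 ∧ ∀ y ∈ N, y ⬝ᵥ ν = 0) ∨
    ∀ y, ∃ n : ℤ, n ≠ 0 ∧ n • y ∈ N := by
  classical
  obtain ⟨k, bM, bN, f, a, snf⟩ := Submodule.smithNormalForm (Pi.basisFun ℤ (Fin d)) N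
  have hN (y) (hy : y ∈ N) : y = ∑ i, (bN.repr ⟨y, hy⟩ i * a i) • bM (f i) := by
    have := congrArg Subtype.val (bN.sum_repr ⟨y, hy⟩)
    simp only [AddSubmonoidClass.coe_finsetSum, SetLike.val_smul, snf, smul_smul] at this
    exact this.symm
  have hk : k ≤ d := by simpa using Fintype.card_le_of_embedding f
  rcases hk.lt_or_eq with hk | rfl
  · left
    refine ⟨k, hk, bM ∘ f, fun y hy => ?_, fun y => ?_, ?_⟩
    · rw [hN y hy]
      exact Submodule.sum_mem _ fun i _ =>
        Submodule.smul_mem _ _ (Submodule.subset_span ⟨i, rfl⟩)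
    · obtain ⟨x, hx⟩ := exists_dotProduct_eq
        (bM.constr ℤ (Function.extend f y 0))
      refine ⟨x, fun i => ?_⟩
      rw [dotProduct_comm, Function.comp, hx, bM.constr_basis, f.injective.extend_apply]
    · obtain ⟨j, hj⟩ : ∃ j, j ∉ range f := by
        by_contra! hcon
        have := Fintype.card_le_of_surjective f hcon
        simp only [Fintype.card_fin] at this
        omega
      obtain ⟨x, hx⟩ := exists_dotProduct_eq (bM.coord j)
      refine ⟨x, ?_, fun y hy => ?_⟩
      · rintro rfl
        have := hx (bM j)
        simp at this
      · rw [hx, hN y hy, map_sum]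
        refine Finset.sum_eq_zero fun i _ => ?_
        have : f i ≠ j := fun h => hj ⟨i, h⟩
        rw [map_smul, bM.coord_apply, bM.repr_self, Finsupp.single_apply, if_neg this, smul_zero]
  · right
    have ha (i) : a i ≠ 0 := by
      intro h0
      have := snf i
      rw [h0, zero_smul] at this
      exact bN.ne_zero i (Subtype.ext this)
    have hf : Function.Surjective f := Finite.surjective_of_injective f.injective
    refine fun y => ⟨∏ i, a i, Finset.prod_ne_zero_iff.2 fun i _ => ha i, ?_⟩
    rw [← bM.sum_repr y, Finset.smul_sum]
    refine Submodule.sum_mem _ fun j _ => ?_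
    obtain ⟨i, rfl⟩ := hf j
    rw [← Finset.mul_prod_erase _ _ (Finset.mem_univ i), mul_comm, mul_smul,
      smul_comm _ (bM.repr _ _), smul_smul, mul_comm, mul_smul, ← snf]
    exact Submodule.smul_mem _ _ (Submodule.smul_mem _ _ (bN i).2)

/-- Pairing with finitely many integral covectors, as a real linear map. -/
def pairing {k : ℕ} (u : Fin k → Fin d → ℤ) : (Fin d → ℝ) →ₗ[ℝ] (Fin k → ℝ) where
  toFun x i := dotR x (intVec (u i))
  map_add' x y := by ext; simp [dotR, add_mul, Finset.sum_add_distrib]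
  map_smul' r x := by ext; simp [dotR, Finset.mul_sum, mul_assoc]

theorem pairing_intVec {k : ℕ} (u : Fin k → Fin d → ℤ) (z : Fin d → ℤ) :
    pairing u (intVec z) = intVec fun i => z ⬝ᵥ u i := by
  ext i
  exact dotR_intVec z (u i)

theorem isLatticeProj_pairing {k : ℕ} {u : Fin k → Fin d → ℤ}
    (hu : ∀ y : Fin k → ℤ, ∃ x : Fin d → ℤ, ∀ i, x ⬝ᵥ u i = y i) :
    IsLatticeProj (pairing u).toAffineMap := by
  ext y
  constructor
  · rintro ⟨_, ⟨z, rfl⟩, rfl⟩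
    exact ⟨_, (pairing_intVec u z).symm⟩
  · rintro ⟨y, rfl⟩
    obtain ⟨x, hx⟩ := hu y
    refine ⟨intVec x, ⟨x, rfl⟩, ?_⟩
    rw [LinearMap.coe_toAffineMap, pairing_intVec]
    exact congrArg intVec (funext hx)

theorem pairing_surjective {k : ℕ} {u : Fin k → Fin d → ℤ}
    (hu : ∀ y : Fin k → ℤ, ∃ x : Fin d → ℤ, ∀ i, x ⬝ᵥ u i = y i) :
    Function.Surjective (pairing u) := by
  classical
  intro y
  choose x hx using fun j : Fin k => hu (Pi.single j 1)
  refine ⟨∑ j, y j • intVec (x j), ?_⟩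
  ext i
  simp [map_sum, map_smul, pairing_intVec, intVec, hx, Finset.sum_apply, Pi.single_apply]

theorem IsLatticePolytope.isCompact {P : Set (Fin d → ℝ)} (hP : IsLatticePolytope P) :
    IsCompact P := by
  obtain ⟨A, -, rfl⟩ := hP
  exact A.finite_toSet.isCompact_convexHull (𝕜 := ℝ)

/-- The covectors of a certificate of a sporadic polytope generate a sublattice of finite index. -/
theorem IsSporadic.exists_smul_mem_span {ι : Type*} [Fintype ι] {P : Set (Fin d → ℝ)}
    (hP : IsSporadic P) {c : ℝ} (hc : c < 1) {ν : ι → Fin d → ℤ} {w : ι → ℝ}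
    (h : IsCert P c ν w) (y : Fin d → ℤ) :
    ∃ n : ℤ, n ≠ 0 ∧ n • y ∈ Submodule.span ℤ (range ν) := by
  classical
  rcases le_primitive_span_or_isTorsion_quotient (Submodule.span ℤ (range ν)) with
    ⟨k, hkd, u, hspan, hu, -⟩ | h'
  swap
  · exact h' y
  exfalso
  obtain ⟨i₀, -, hi₀⟩ := Finset.exists_ne_zero_of_sum_ne_zero h.2.2.1.ne'
  have hcoef (i : ι) : ∃ q : Fin k → ℤ, ∑ j, q j • u j = ν i :=
    (Submodule.mem_span_range_iff_exists_fun ℤ).1 (hspan (Submodule.subset_span ⟨i, rfl⟩))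
  choose q hq using hcoef
  have hq0 (i : ι) : q i ≠ 0 := by
    intro h0
    apply h.1 i
    rw [← hq i, h0]
    simp
  have hk : 1 ≤ k := by
    rcases Nat.eq_zero_or_pos k with rfl | hk
    · exact absurd (Subsingleton.elim (q i₀) 0) (hq0 i₀)
    · exact hk
  have hpair (i : ι) (x : Fin d → ℝ) :
      dotR (pairing u x) (intVec (q i)) = dotR x (intVec (ν i)) := by
    rw [← dotR_sum_right Finset.univ x (fun j => (q i j : ℝ)) (fun j => intVec (u j))
      (intVec (ν i)) fun k => ?_]
    · simp only [dotR, pairing, LinearMap.coe_mk, AddHom.coe_mk, intVec]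
      exact Finset.sum_congr rfl fun j _ => mul_comm _ _
    · have := congrFun (hq i) k
      simp only [Finset.sum_apply, Pi.smul_apply, smul_eq_mul] at this
      simp only [intVec]
      exact_mod_cast this
  have hsurj := pairing_surjective hu
  refine hP.2.2.2 ⟨k, hk, by omega, (pairing u).toAffineMap, isLatticeProj_pairing hu, ?_, ?_, ?_⟩
  · obtain ⟨A, hA, rfl⟩ := hP.1
    refine ⟨A.image (pairing u).toAffineMap, ?_, ?_⟩
    · rw [Finset.coe_image, ← isLatticeProj_pairing hu]
      exact image_mono hA
    · rw [Finset.coe_image, AffineMap.image_convexHull]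
  · exact AffineMap.span_eq_top_of_surjective _ hsurj hP.2.1
  · refine eq_empty_iff_forall_notMem.2 fun y hy => ?_
    obtain ⟨x, rfl⟩ := hsurj y
    have hm (i : ι) : MinP P (intVec (ν i)) + 1 ≤ dotR x (intVec (ν i)) := by
      have h1 := hy (q i) (hq0 i)
      have h2 : MinP ((pairing u).toAffineMap '' P) (intVec (q i)) = MinP P (intVec (ν i)) := by
        rw [MinP, MinP, image_image]
        congr 1
        exact image_congr fun x _ => hpair i x
      rwa [h2, hpair] at h1
    have h1 : ∑ i, w i * (MinP P (intVec (ν i)) + 1) ≤ 0 := by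
      rw [← h.sum_dotR x]
      exact Finset.sum_le_sum fun i _ => mul_le_mul_of_nonneg_left (hm i) (h.2.1 i)
    have h2 := h.2.2.2.2
    have h3 := h.2.2.1
    simp only [mul_add, Finset.sum_add_distrib, ← Finset.sum_mul] at h1 h2
    nlinarith

/-- Covectors with a unique linear relation generating a sublattice of finite index are `d + 1`
in number. -/
theorem card_eq_of_unique_relation {r : ℕ} {ν : Fin r → Fin d → ℤ} {w : Fin r → ℝ} (hw : w ≠ 0)
    (hrel : ∀ k, ∑ i, w i * (ν i k : ℝ) = 0)
    (huniq : ∀ u : Fin r → ℝ, (∀ k, ∑ i, u i * (ν i k : ℝ) = 0) → ∃ t : ℝ, u = t • w)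
    (hfin : ∀ y, ∃ n : ℤ, n ≠ 0 ∧ n • y ∈ Submodule.span ℤ (range ν)) : r = d + 1 := by
  classical
  let Φ : (Fin r → ℝ) →ₗ[ℝ] (Fin d → ℝ) := Fintype.linearCombination ℝ fun i => intVec (ν i)
  have hΦ (u : Fin r → ℝ) (k) : Φ u k = ∑ i, u i * (ν i k : ℝ) := by
    simp [Φ, Fintype.linearCombination_apply, Finset.sum_apply, intVec]
  have hker : Φ.ker = Submodule.span ℝ {w} := by
    ext u
    rw [LinearMap.mem_ker, Submodule.mem_span_singleton]
    constructor
    · intro hu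
      obtain ⟨t, ht⟩ := huniq u fun k => by rw [← hΦ, hu]; rfl
      exact ⟨t, ht.symm⟩
    · rintro ⟨t, rfl⟩
      rw [map_smul]
      convert smul_zero t
      ext k
      rw [hΦ, hrel]
      rfl
  have hrange : Φ.range = ⊤ := by
    rw [eq_top_iff, ← (Pi.basisFun ℝ (Fin d)).span_eq, Submodule.span_le]
    rintro _ ⟨k, rfl⟩
    obtain ⟨n, hn, hmem⟩ := hfin (Pi.single k 1)
    obtain ⟨q, hq⟩ := (Submodule.mem_span_range_iff_exists_fun ℤ).1 hmem
    refine ⟨fun i => (q i : ℝ) / n, ?_⟩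
    ext j
    have h1 := congrFun hq j
    simp only [Finset.sum_apply, Pi.smul_apply, smul_eq_mul] at h1
    have h2 : ∑ i, (q i : ℝ) * (ν i j : ℝ) = n * ((Pi.single k 1 : Fin d → ℤ) j : ℝ) := by
      exact_mod_cast h1
    have hn' : (n : ℝ) ≠ 0 := by exact_mod_cast hn
    rw [hΦ]
    simp only [div_mul_eq_mul_div, ← Finset.sum_div, h2, Pi.basisFun_apply, Pi.single_apply]
    field_simp
    simp
  have := Φ.finrank_range_add_finrank_ker
  rw [hker, hrange, finrank_span_singleton hw, finrank_top] at this
  simpa using this.symm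

theorem IsFullDim.exists_dotProduct_ne {A : Set (Fin d → ℤ)}
    (h : IsFullDim (convexHull ℝ (intVec '' A))) {ν : Fin d → ℤ} (hν : ν ≠ 0) :
    ∃ a ∈ A, ∃ b ∈ A, a ⬝ᵥ ν ≠ b ⬝ᵥ ν := by
  by_contra! hcon
  apply hν
  have hle : vectorSpan ℝ (intVec '' A) ≤ (pairing fun _ : Fin 1 => ν).ker := by
    rw [vectorSpan_def, Submodule.span_le]
    rintro _ ⟨_, ⟨a, ha, rfl⟩, _, ⟨b, hb, rfl⟩, rfl⟩
    simp only [vsub_eq_sub, SetLike.mem_coe, LinearMap.mem_ker, map_sub, pairing_intVec,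
      hcon a ha b hb, sub_self]
  rw [← direction_affineSpan, ← affineSpan_convexHull, h, AffineSubspace.direction_top] at hle
  have h1 : pairing (fun _ : Fin 1 => ν) (intVec ν) = 0 := hle Submodule.mem_top
  rw [pairing_intVec] at h1
  have h2 := congrFun h1 0
  simp only [intVec, Pi.zero_apply, Int.cast_eq_zero] at h2
  exact dotProduct_self_eq_zero.1 h2

theorem IsFullDim.exists_smul_mem_span {A : Set (Fin d → ℤ)}
    (h : IsFullDim (convexHull ℝ (intVec '' A))) (v y : Fin d → ℤ) :
    ∃ n : ℤ, n ≠ 0 ∧ n • y ∈ Submodule.span ℤ ((fun a => a - v) '' A) := by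
  rcases le_primitive_span_or_isTorsion_quotient (Submodule.span ℤ ((fun a => a - v) '' A)) with
    ⟨-, -, -, -, -, ν, hν, hort⟩ | h'
  · obtain ⟨a, ha, b, hb, hab⟩ := h.exists_dotProduct_ne hν
    have h1 := hort _ (Submodule.subset_span ⟨a, ha, rfl⟩)
    have h2 := hort _ (Submodule.subset_span ⟨b, hb, rfl⟩)
    simp only [sub_dotProduct] at h1 h2
    omega
  · exact h' y

theorem IsLatticePolytope.exists_finset {P : Set (Fin d → ℝ)} (hP : IsLatticePolytope P) :
    ∃ A : Finset (Fin d → ℤ), P = convexHull ℝ (intVec '' (A : Set (Fin d → ℤ))) := by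
  classical
  obtain ⟨A, hA, rfl⟩ := hP
  have hinj : Function.Injective (intVec : (Fin d → ℤ) → Fin d → ℝ) := fun x y hxy =>
    funext fun i => by
      have := congrFun hxy i
      simpa [intVec] using this
  refine ⟨A.preimage intVec hinj.injOn, ?_⟩
  rw [Finset.coe_preimage, image_preimage_eq_of_subset hA]

/-- There are `d + 1` integral covectors, generating a sublattice of finite index, along which a
sporadic polytope has uniformly bounded width. -/
theorem IsSporadic.exists_bounded_width (hd : 0 < d) :
    ∃ q : ℕ, ∀ P : Set (Fin d → ℝ), IsSporadic P → ∀ A : Finset (Fin d → ℤ),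
      P = convexHull ℝ (intVec '' (A : Set (Fin d → ℤ))) →
      ∃ ν : Fin (d + 1) → Fin d → ℤ,
        (∀ y, ∃ n : ℤ, n ≠ 0 ∧ n • y ∈ Submodule.span ℤ (range ν)) ∧
        ∀ a ∈ A, ∀ b ∈ A, ∀ i, |a ⬝ᵥ ν i - b ⬝ᵥ ν i| ≤ q := by
  obtain ⟨q, hq⟩ := exists_uniform_bound_or_near_nat (d + 1)
  refine ⟨q + 1, fun P hP A hA => ?_⟩
  have hcomp := hP.1.isCompact
  have hAP (a) (ha : a ∈ A) : intVec a ∈ P := by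
    rw [hA]
    exact subset_convexHull ℝ _ ⟨a, ha, rfl⟩
  have hfull (ν : Fin d → ℤ) (hν : ν ≠ 0) : ∃ a ∈ A, ∃ b ∈ A, a ⬝ᵥ ν ≠ b ⬝ᵥ ν :=
    IsFullDim.exists_dotProduct_ne (hA ▸ hP.2.1) hν
  have hAne : A.Nonempty := by
    obtain ⟨a, ha, -⟩ := hfull (Pi.single ⟨0, hd⟩ 1) (by simp)
    exact ⟨a, ha⟩
  have hPne : P.Nonempty := hAne.elim fun a ha => ⟨_, hAP a ha⟩
  set C : Set ℝ := {c | ∃ (r : ℕ) (ν : Fin r → Fin d → ℤ) (w : Fin r → ℝ), IsCert P c ν w}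
  have hlow : ∀ c ∈ C, 1 / (A.card : ℝ) ≤ c := by
    rintro c ⟨r, ν, w, h⟩
    exact h.one_div_card_le hAne hcomp hAP hfull
  have hbdd : BddBelow C := ⟨_, hlow⟩
  obtain ⟨c₁, hc₁, hc₁C⟩ := hP.2.2.1.exists_isCert
  have hCne : C.Nonempty := ⟨c₁, hc₁C⟩
  have hpos : 0 < sInf C :=
    lt_of_lt_of_le (by have := hAne.card_pos; positivity) (le_csInf hCne hlow)
  have hlt : sInf C < min 1 (sInf C * (1 + 1 / (2 * q + 1))) := by
    refine lt_min ((csInf_le hbdd hc₁C).trans_lt hc₁) (lt_mul_of_one_lt_right hpos ?_)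
    have : (0 : ℝ) < 1 / (2 * q + 1) := by positivity
    linarith
  obtain ⟨c, hcC, hc⟩ := exists_lt_of_csInf_lt hCne hlt
  have hc1 : c < 1 := hc.trans_le (min_le_left _ _)
  have hc2 := hc.trans_le (min_le_right _ _)
  obtain ⟨r, ν, w, h, hw, hsum, huniq⟩ := exists_reduced_isCert hcC
  have hfin := hP.exists_smul_mem_span hc1 h
  obtain rfl : r = d + 1 := card_eq_of_unique_relation (fun h0 => by simp [h0] at hsum)
    h.2.2.2.1 huniq hfin
  have hlam : ∀ i, 1 / ((q : ℝ) + 1) < w i := by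
    refine (hq w (fun i => (hw i).le) hsum).resolve_right ?_
    rintro ⟨s, n, hs, hsq, hn, hz, hle, hsn⟩
    have h1 : sInf C ≤ s * c / (1 + ∑ i, (n i : ℝ)) :=
      csInf_le hbdd (h.improve hcomp hPne hsum hw huniq hs hn hz hle)
    rw [le_div_iff₀ (by positivity)] at h1
    have h2 : s * (1 / (2 * q + 1)) < 1 / 2 := by
      rw [mul_one_div, div_lt_div_iff₀ (by positivity) (by positivity)]
      linarith
    have h3 := mul_lt_mul_of_pos_left hc2 hs
    have h4 : sInf C * (s + 1 / 2) < sInf C * (1 + ∑ i, (n i : ℝ)) :=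
      mul_lt_mul_of_pos_left (by linarith) hpos
    have h5 := mul_lt_mul_of_pos_left h2 hpos
    linarith
  have hwm : -c ≤ ∑ i, w i * MinP P (intVec (ν i)) := by
    have := h.2.2.2.2
    simp only [mul_add, Finset.sum_add_distrib, ← Finset.sum_mul, hsum] at this
    linarith
  have hheight (a) (ha : a ∈ A) (i) : 0 ≤ dotR (intVec a) (intVec (ν i)) - MinP P (intVec (ν i)) ∧
      dotR (intVec a) (intVec (ν i)) - MinP P (intVec (ν i)) < q + 1 := by
    have hnn (i) := sub_nonneg.2 (minP_le hcomp (intVec (ν i)) (hAP a ha))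
    refine ⟨hnn i, ?_⟩
    have h1 : w i * (dotR (intVec a) (intVec (ν i)) - MinP P (intVec (ν i))) ≤ c := by
      refine (Finset.single_le_sum (f := fun i => w i *
        (dotR (intVec a) (intVec (ν i)) - MinP P (intVec (ν i))))
        (fun i _ => mul_nonneg (hw i).le (hnn i)) (Finset.mem_univ i)).trans ?_
      simp only [mul_sub, Finset.sum_sub_distrib, h.sum_dotR]
      linarith
    have h2 := hlam i
    rw [div_lt_iff₀ (by positivity)] at h2
    by_contra! hcon
    have := mul_le_mul_of_nonneg_left hcon (hw i).le
    linarith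
  refine ⟨ν, hfin, fun a ha b hb i => ?_⟩
  have h1 := hheight a ha i
  have h2 := hheight b hb i
  rw [dotR_intVec] at h1 h2
  have h3 : |((a ⬝ᵥ ν i : ℤ) : ℝ) - ((b ⬝ᵥ ν i : ℤ) : ℝ)| ≤ q + 1 := by
    rw [abs_le]
    constructor <;> linarith
  exact_mod_cast h3

theorem exists_real_extension (E : (Fin d → ℤ) →ₗ[ℤ] (Fin d → ℤ)) :
    ∃ R : (Fin d → ℝ) →ₗ[ℝ] (Fin d → ℝ), ∀ z, R (intVec z) = intVec (E z) := by
  choose u hu using fun j => exists_dotProduct_eq (LinearMap.proj j ∘ₗ E)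
  refine ⟨pairing u, fun z => ?_⟩
  rw [pairing_intVec]
  exact congrArg intVec (funext fun j => hu j z)

theorem linearMap_ext_intVec {f g : (Fin d → ℝ) →ₗ[ℝ] (Fin d → ℝ)}
    (h : ∀ z, f (intVec z) = g (intVec z)) : f = g := by
  classical
  refine (Pi.basisFun ℝ (Fin d)).ext fun i => ?_
  convert h (Pi.single i 1) <;>
  · ext j
    simp [intVec, Pi.single_apply]

theorem exists_real_equiv (E : (Fin d → ℤ) ≃ₗ[ℤ] (Fin d → ℤ)) :
    ∃ R : (Fin d → ℝ) ≃ₗ[ℝ] (Fin d → ℝ), ∀ z, R (intVec z) = intVec (E z) := by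
  obtain ⟨R, hR⟩ := exists_real_extension E.toLinearMap
  obtain ⟨R', hR'⟩ := exists_real_extension E.symm.toLinearMap
  exact ⟨LinearEquiv.ofLinearMap R R' (linearMap_ext_intVec fun z => by simp [hR, hR'])
    (linearMap_ext_intVec fun z => by simp [hR, hR']), hR⟩

/-- `P` is spanned by lattice points whose differences to a base point are mapped onto `X` by a
lattice embedding with image `M`. -/
def IsEncodedBy {m : ℕ} (P : Set (Fin d → ℝ)) (X : Set (Fin m → ℤ))
    (M : Submodule ℤ (Fin m → ℤ)) : Prop :=
  ∃ (A : Set (Fin d → ℤ)) (v : Fin d → ℤ) (T : (Fin d → ℤ) →ₗ[ℤ] (Fin m → ℤ)),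
    P = convexHull ℝ (intVec '' A) ∧ Function.Injective T ∧ (fun a => T (a - v)) '' A = X ∧
      T.range = M

theorem IsEncodedBy.unimodEquiv {m : ℕ} {P P' : Set (Fin d → ℝ)} {X : Set (Fin m → ℤ)}
    {M : Submodule ℤ (Fin m → ℤ)} (h : IsEncodedBy P X M) (h' : IsEncodedBy P' X M) :
    UnimodEquiv P P' := by
  obtain ⟨A, v, T, rfl, hT, hX, hM⟩ := h
  obtain ⟨A', v', T', rfl, hT', hX', hM'⟩ := h'
  let E : (Fin d → ℤ) ≃ₗ[ℤ] (Fin d → ℤ) := (LinearEquiv.ofInjective T hT).trans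
    ((LinearEquiv.ofEq _ _ (hM.trans hM'.symm)).trans (LinearEquiv.ofInjective T' hT').symm)
  have hE (x) : T' (E x) = T x := by
    have := (LinearEquiv.ofInjective T' hT').apply_symm_apply
      (LinearEquiv.ofEq _ _ (hM.trans hM'.symm) (LinearEquiv.ofInjective T hT x))
    exact congrArg Subtype.val this
  obtain ⟨R, hR⟩ := exists_real_equiv E
  have hφ (z : Fin d → ℤ) : (R.toAffineEquiv.trans
      (AffineEquiv.constVAdd ℝ (Fin d → ℝ) (intVec (v' - E v)))) (intVec z) =
      intVec (v' + E (z - v)) := by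
    ext i
    simp [hR, intVec]
    ring
  have hA' : (fun z => v' + E (z - v)) '' A = A' := by
    ext a'
    constructor
    · rintro ⟨a, ha, rfl⟩
      obtain ⟨b, hb, hb'⟩ : T (a - v) ∈ (fun a => T' (a - v')) '' A' := by
        rw [hX', ← hX]
        exact ⟨a, ha, rfl⟩
      rw [← hE] at hb'
      have := hT' hb'
      simpa [← this] using hb
    · intro ha'
      obtain ⟨a, ha, hab⟩ : T' (a' - v') ∈ (fun a => T (a - v)) '' A := by
        rw [hX, ← hX']
        exact ⟨a', ha', rfl⟩
      refine ⟨a, ha, ?_⟩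
      simp only [← hE] at hab
      simp [hT' hab]
  refine ⟨R.toAffineEquiv.trans
    (AffineEquiv.constVAdd ℝ (Fin d → ℝ) (intVec (v' - E v))), ?_, ?_⟩
  · ext y
    constructor
    · rintro ⟨_, ⟨z, rfl⟩, rfl⟩
      exact ⟨_, (hφ z).symm⟩
    · rintro ⟨z, rfl⟩
      refine ⟨_, ⟨E.symm (z - v') + v, rfl⟩, ?_⟩
      rw [hφ]
      simp
  · rw [← hA', ← AffineEquiv.coe_toAffineMap, AffineMap.image_convexHull]
    simp only [image_image, AffineEquiv.coe_toAffineMap, hφ]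

theorem finite_setOf_torsion_overmodules {G : Type*} [AddCommGroup G] [Module.Finite ℤ G]
    (N : Submodule ℤ G) :
    {M : Submodule ℤ G | N ≤ M ∧ ∀ y ∈ M, ∃ n : ℤ, n ≠ 0 ∧ n • y ∈ N}.Finite := by
  have hfin : (Submodule.torsion ℤ (G ⧸ N) : Set (G ⧸ N)).Finite :=
    Module.finite_of_fg_torsion (Submodule.torsion ℤ (G ⧸ N)) (Submodule.torsion_isTorsion)
  refine Set.Finite.of_injOn (f := fun M => (M.map N.mkQ : Set (G ⧸ N))) ?_ ?_
    hfin.finite_subsets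
  · rintro M ⟨-, hM⟩ _ ⟨y, hy, rfl⟩
    obtain ⟨n, hn, hmem⟩ := hM y hy
    refine (Submodule.mem_torsion_iff _).2 ⟨⟨n, mem_nonZeroDivisors_of_ne_zero hn⟩, ?_⟩
    rw [Submonoid.smul_def, ← map_smul]
    exact (Submodule.Quotient.mk_eq_zero N).2 hmem
  · rintro M ⟨hM, -⟩ M' ⟨hM', -⟩ heq
    have h1 := congrArg (Submodule.comap N.mkQ) (SetLike.coe_injective heq)
    rwa [Submodule.comap_map_mkQ, Submodule.comap_map_mkQ, sup_eq_right.2 hM,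
      sup_eq_right.2 hM'] at h1

theorem IsSporadic.exists_isEncodedBy (hd : 0 < d) :
    ∃ S : Set (Set (Fin (d + 1) → ℤ) × Submodule ℤ (Fin (d + 1) → ℤ)), S.Finite ∧
      ∀ P : Set (Fin d → ℝ), IsSporadic P → ∃ p ∈ S, IsEncodedBy P p.1 p.2 := by
  obtain ⟨q, hq⟩ := IsSporadic.exists_bounded_width hd
  let B : Set (Fin (d + 1) → ℤ) := Icc (fun _ => -q) fun _ => q
  refine ⟨⋃ X ∈ {X | X ⊆ B}, Prod.mk X '' {M | Submodule.span ℤ X ≤ M ∧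
    ∀ y ∈ M, ∃ n : ℤ, n ≠ 0 ∧ n • y ∈ Submodule.span ℤ X}, ?_, fun P hP => ?_⟩
  · exact (finite_Icc _ _).finite_subsets.biUnion fun X _ =>
      (finite_setOf_torsion_overmodules _).image _
  obtain ⟨A, hA⟩ := hP.1.exists_finset
  obtain ⟨ν, hν, hwidth⟩ := hq P hP A hA
  have hfull : IsFullDim (convexHull ℝ (intVec '' (A : Set (Fin d → ℤ)))) := hA ▸ hP.2.1
  obtain ⟨v, hv, -⟩ := hfull.exists_dotProduct_ne (ν := Pi.single ⟨0, hd⟩ 1) (by simp)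
  let T : (Fin d → ℤ) →ₗ[ℤ] (Fin (d + 1) → ℤ) := Matrix.mulVecLin ν
  have hT (x : Fin d → ℤ) (i : Fin (d + 1)) : T x i = x ⬝ᵥ ν i := dotProduct_comm (ν i) x
  have hinj : Function.Injective T := by
    rw [← LinearMap.ker_eq_bot, LinearMap.ker_eq_bot']
    intro x hx
    obtain ⟨n, hn, hmem⟩ := hν x
    obtain ⟨c, hc⟩ := (Submodule.mem_span_range_iff_exists_fun ℤ).1 hmem
    have h1 : x ⬝ᵥ (n • x) = 0 := by
      rw [← hc, dotProduct_sum]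
      refine Finset.sum_eq_zero fun i _ => ?_
      rw [dotProduct_smul, ← hT, hx]
      simp
    rw [dotProduct_smul, smul_eq_mul] at h1
    exact dotProduct_self_eq_zero.1 ((mul_eq_zero.1 h1).resolve_left hn)
  refine ⟨((fun a => T (a - v)) '' A, T.range), ?_, A, v, T, hA, hinj, rfl, rfl⟩
  simp only [mem_iUnion]
  refine ⟨_, ?_, T.range, ⟨?_, ?_⟩, rfl⟩
  · rintro _ ⟨a, ha, rfl⟩
    have h1 (i) := abs_le.1 (hwidth a ha v hv i)
    refine ⟨fun i => ?_, fun i => ?_⟩ <;> simp only [hT, sub_dotProduct]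
    · exact (h1 i).1
    · exact (h1 i).2
  · rw [Submodule.span_le]
    rintro _ ⟨a, -, rfl⟩
    exact ⟨_, rfl⟩
  · rintro _ ⟨y, rfl⟩
    obtain ⟨n, hn, hmem⟩ := hfull.exists_smul_mem_span v y
    refine ⟨n, hn, ?_⟩
    have := Submodule.mem_map_of_mem (f := T) hmem
    rwa [Submodule.map_span, image_image, map_smul] at this

end

/-- In each dimension `d` there are, up to unimodular equivalence,
only finitely many `d`-dimensional sporadic F-hollow lattice polytopes. -/
theorem finitely_many_sporadic (d : ℕ) (hd : 0 < d) :
    ∃ (N : ℕ) (Ps : Fin N → Set (Fin d → ℝ)),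
      (∀ i, IsLatticePolytope (Ps i) ∧ IsFullDim (Ps i)) ∧
      ∀ P : Set (Fin d → ℝ), IsSporadic P → ∃ i, UnimodEquiv P (Ps i) := by
  classical
  obtain ⟨S, hS, hcode⟩ := IsSporadic.exists_isEncodedBy hd
  let S' := {p ∈ S | ∃ P : Set (Fin d → ℝ), IsSporadic P ∧ IsEncodedBy P p.1 p.2}
  have hS' : S'.Finite := hS.subset (sep_subset _ _)
  have : Fintype S' := hS'.fintype
  choose rep hrep henc using fun p : S' => p.2.2
  let e := Fintype.equivFin S'
  refine ⟨Fintype.card S', fun i => rep (e.symm i), fun i => ⟨(hrep _).1, (hrep _).2.1⟩,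
    fun P hP => ?_⟩
  obtain ⟨p, hp, hPp⟩ := hcode P hP
  refine ⟨e ⟨p, hp, P, hP, hPp⟩, ?_⟩
  simp only [Equiv.symm_apply_apply]
  exact hPp.unimodEquiv (henc _)
end
end

section
/- For every positive integer d there exist, up to unimodular equivalence, only finitely many d-dimensional weakly sporadic F-hollow lattice polytopes; i.e., there is a finite list Q₁, …, Q_N of d-dimensional lattice polytopes in ℝ^d such that every d-dimensional weakly sporadic F-hollow lattice polytope is unimodular equivalent to some Q_i. -/
open Set MeasureTheory

noncomputable section

/-- Dirichlet's simultaneous approximation theorem with a uniform bound on the denominator. -/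
theorem exists_simultaneous_approx_s1 (n : ℕ) {ε : ℝ} (hε : 0 < ε) :
    ∃ N₀ : ℕ, ∀ u : Fin n → ℝ, ∃ N : ℕ, 1 ≤ N ∧ N ≤ N₀ ∧
      ∃ z : Fin n → ℤ, ∀ i, |N * u i - z i| ≤ ε := by
  obtain ⟨k, hk⟩ := exists_nat_gt (1 / ε)
  have hk0 : (0 : ℝ) < k := lt_trans (by positivity) hk
  have hkε : 1 / (k : ℝ) ≤ ε := by
    rw [div_le_iff₀ hk0]
    rw [div_lt_iff₀ hε] at hk
    linarith
  refine ⟨k ^ n, fun u => ?_⟩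
  have hb : ∀ (N : ℕ) (i : Fin n), ⌊k * Int.fract (N * u i)⌋₊ < k := fun N i => by
    rw [Nat.floor_lt (by positivity)]
    nlinarith [Int.fract_lt_one (N * u i)]
  obtain ⟨a, b, hab, hf⟩ := Fintype.exists_ne_map_eq_of_card_lt
    (fun (N : Fin (k ^ n + 1)) (i : Fin n) => (⟨_, hb N i⟩ : Fin k)) (by simp)
  wlog hlt : a < b generalizing a b
  · exact this b a hab.symm hf.symm (lt_of_le_of_ne (not_lt.mp hlt) hab.symm)
  have hlt' : (a : ℕ) < b := hlt
  refine ⟨b - a, by omega, by omega, fun i => ⌊b * u i⌋ - ⌊a * u i⌋, fun i => ?_⟩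
  have h1 : ⌊k * Int.fract (a * u i)⌋₊ = ⌊k * Int.fract (b * u i)⌋₊ := by
    simpa using congrFun hf i
  have ha := Nat.floor_le (a := k * Int.fract (a * u i)) (by positivity)
  have ha' := Nat.lt_floor_add_one (k * Int.fract (a * u i))
  have hb := Nat.floor_le (a := k * Int.fract (b * u i)) (by positivity)
  have hb' := Nat.lt_floor_add_one (k * Int.fract (b * u i))
  rw [h1] at ha ha'
  refine le_trans ?_ hkε
  rw [le_div_iff₀ hk0, ← abs_of_pos hk0, ← abs_mul, abs_le]
  push_cast [Nat.cast_sub hlt'.le]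
  have e : ((b : ℝ) - a) * u i - (⌊b * u i⌋ - ⌊a * u i⌋)
      = Int.fract (b * u i) - Int.fract (a * u i) := by
    simp only [Int.fract]; ring
  rw [e]
  constructor <;> nlinarith

/-- A subspace of coefficient vectors is lattice-free if an integer vector lies in it as soon as it
is congruent modulo it to a nonnegative vector with coordinate sum less than one. -/
def LatticeFree {n : ℕ} (R : Submodule ℝ (Fin n → ℝ)) : Prop :=
  ∀ (z : Fin n → ℤ) (y : Fin n → ℝ), (∀ i, 0 ≤ y i) → ∑ i, y i < 1 →
    (y - fun i => (z i : ℝ)) ∈ R → (fun i => (z i : ℝ)) ∈ R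

/-- `w` vanishes outside `T` and lies between `1` and `C` on `T`. -/
def BoundedOn {n : ℕ} (T : Finset (Fin n)) (C : ℝ) (w : Fin n → ℝ) : Prop :=
  (∀ i ∉ T, w i = 0) ∧ ∀ i ∈ T, 1 ≤ w i ∧ w i ≤ C

theorem LatticeFree.exists_halved {n : ℕ} (T : Finset (Fin n)) (C : ℝ) :
    ∃ L₀ : ℝ, 0 < L₀ ∧ ∀ R : Submodule ℝ (Fin n → ℝ), LatticeFree R →
      (∃ w ∈ R, BoundedOn T C w) → ∀ r ∈ R, (∀ i ∉ T, 0 ≤ r i) → ∑ i ∈ Tᶜ, r i = 1 →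
      ∀ L : ℝ, L₀ ≤ L → (∀ i ∈ T, |r i| ≤ L) →
      ∃ r' ∈ R, (∀ i ∉ T, r' i = r i) ∧ ∀ i ∈ T, |r' i| ≤ L / 3 := by
  set ε : ℝ := 1 / (3 * (n + 1) * (|C| + 1)) with hε
  have hC := abs_nonneg C
  have hεpos : 0 < ε := by positivity
  have hε3 : ε ≤ 1 / 3 := by
    rw [hε]
    apply one_div_le_one_div_of_le (by norm_num)
    have : (0 : ℝ) ≤ n := by positivity
    nlinarith [mul_nonneg this hC]
  obtain ⟨N₀, hN₀⟩ := exists_simultaneous_approx_s1 n hεpos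
  refine ⟨3 * (N₀ + 1), by positivity, ?_⟩
  rintro R hR ⟨w, hwR, hw0, hw1⟩ r hr hr0 hr1 L hL hrL
  have hLpos : 0 < L := lt_of_lt_of_le (by positivity) hL
  obtain ⟨N, hN1, hNN, z, hz⟩ := hN₀ (fun i => r i / L)
  have hNr : (1 : ℝ) ≤ N := by exact_mod_cast hN1
  have hNr' : (N : ℝ) ≤ N₀ := by exact_mod_cast hNN
  set z' : Fin n → ℤ := fun i => if i ∈ T then z i else 0 with hz'
  set y : Fin n → ℝ := (N / L) • r + ε • w - fun i => (z' i : ℝ) with hy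
  have hyT : ∀ i ∈ T, 0 ≤ y i ∧ y i ≤ ε * (1 + |C|) := by
    intro i hi
    have h := abs_le.mp (hz i)
    have hw := hw1 i hi
    have hwC := hw.2.trans (le_abs_self C)
    have e : y i = N * (r i / L) - z i + ε * w i := by
      simp [hy, hz', hi]; ring
    rw [e]
    constructor <;> nlinarith
  have hyT' : ∀ i ∉ T, y i = N / L * r i := by
    intro i hi
    simp [hy, hz', hi, hw0 i hi]
  have hzR : (fun i => ((-z') i : ℝ)) ∈ R → (fun i => (z' i : ℝ)) ∈ R := fun h => by
    convert R.neg_mem h using 1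
    ext i; simp
  have key : (fun i => (z' i : ℝ)) ∈ R := by
    have : (fun i => (((-z') i : ℤ) : ℝ)) ∈ R := by
      refine hR (-z') y ?_ ?_ ?_
      · intro i
        by_cases hi : i ∈ T
        · exact (hyT i hi).1
        · rw [hyT' i hi]
          have := hr0 i hi
          positivity
      · rw [← Finset.sum_add_sum_compl T]
        have h1 : ∑ i ∈ T, y i ≤ 1 / 3 := by
          calc ∑ i ∈ T, y i ≤ ∑ i ∈ T, ε * (1 + |C|) :=
                Finset.sum_le_sum fun i hi => (hyT i hi).2
            _ = T.card * (ε * (1 + |C|)) := by simp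
            _ ≤ (n + 1) * (ε * (1 + |C|)) := by
                have : (T.card : ℝ) ≤ n := by
                  exact_mod_cast (Finset.card_le_univ T).trans (by simp)
                gcongr
                linarith
            _ = 1 / 3 := by rw [hε]; field_simp; ring
        have h2 : ∑ i ∈ Tᶜ, y i ≤ 1 / 3 := by
          calc ∑ i ∈ Tᶜ, y i = ∑ i ∈ Tᶜ, N / L * r i :=
                Finset.sum_congr rfl fun i hi => hyT' i (by simpa using hi)
            _ = N / L := by rw [← Finset.mul_sum, hr1, mul_one]
            _ ≤ 1 / 3 := by rw [div_le_div_iff₀ hLpos (by norm_num)]; linarith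
        linarith
      · have : (y - fun i => (((-z') i : ℤ) : ℝ)) = (N / L) • r + ε • w := by
          ext i; simp [hy]
        rw [this]
        exact R.add_mem (R.smul_mem _ hr) (R.smul_mem _ hwR)
    apply hzR
    simpa using this
  refine ⟨r - (L / N) • fun i => (z' i : ℝ), R.sub_mem hr (R.smul_mem _ key), ?_, ?_⟩
  · intro i hi
    simp [hz', hi]
  · intro i hi
    have e : (r - (L / N) • fun i => (z' i : ℝ)) i = (L / N) * (N * (r i / L) - z i) := by
      simp [hz', hi]; field_simp
    rw [e, abs_mul, abs_of_pos (by positivity)]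
    calc L / N * |N * (r i / L) - z i| ≤ L / 1 * (1 / 3) := by
          gcongr
          exact (hz i).trans hε3
      _ = L / 3 := by ring

theorem LatticeFree.exists_bounded_extension {n : ℕ} (T : Finset (Fin n)) (C : ℝ) :
    ∃ L₁ : ℝ, ∀ R : Submodule ℝ (Fin n → ℝ), LatticeFree R →
      (∃ w ∈ R, BoundedOn T C w) → (∃ r ∈ R, (∀ i ∉ T, 0 ≤ r i) ∧ ∑ i ∈ Tᶜ, r i = 1) →
      ∃ p ∈ R, (∀ i ∈ T, 1 ≤ p i ∧ p i ≤ L₁) ∧ (∀ i ∉ T, 0 ≤ p i) ∧ ∑ i ∈ Tᶜ, p i = 1 := by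
  obtain ⟨L₀, hL₀, H⟩ := LatticeFree.exists_halved T C
  refine ⟨L₀ + (L₀ + 1) * |C|, ?_⟩
  rintro R hR ⟨w, hwR, hw⟩ ⟨r, hr, hr0, hr1⟩
  have step : ∀ k : ℕ, ∀ r ∈ R, (∀ i ∉ T, 0 ≤ r i) → ∑ i ∈ Tᶜ, r i = 1 →
      (∀ i ∈ T, |r i| ≤ 3 ^ k * L₀) →
      ∃ r' ∈ R, (∀ i ∉ T, r' i = r i) ∧ ∀ i ∈ T, |r' i| ≤ L₀ := by
    intro k
    induction k with
    | zero => exact fun r hr _ _ h => ⟨r, hr, fun _ _ => rfl, by simpa using h⟩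
    | succ k ih =>
      intro r hr hr0 hr1 h
      obtain ⟨r', hr', he, hb⟩ := H R hR ⟨w, hwR, hw⟩ r hr hr0 hr1 (3 ^ (k + 1) * L₀)
        (le_mul_of_one_le_left hL₀.le (one_le_pow₀ (by norm_num))) h
      obtain ⟨r'', hr'', he', hb'⟩ := ih r' hr' (fun i hi => by rw [he i hi]; exact hr0 i hi)
        (by rw [← hr1]; exact Finset.sum_congr rfl fun i hi => he i (by simpa using hi))
        (fun i hi => (hb i hi).trans_eq (by ring))
      exact ⟨r'', hr'', fun i hi => (he' i hi).trans (he i hi), hb'⟩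
  obtain ⟨k, hk⟩ := pow_unbounded_of_one_lt ((∑ i, |r i|) / L₀) (show (1 : ℝ) < 3 by norm_num)
  rw [div_lt_iff₀ hL₀] at hk
  obtain ⟨r', hr', he, hb⟩ := step k r hr hr0 hr1 fun i _ =>
    (Finset.single_le_sum (f := fun i => |r i|) (fun _ _ => abs_nonneg _)
      (Finset.mem_univ i)).trans hk.le
  have hoff : ∀ i ∉ T, (r' + (L₀ + 1) • w) i = r i := fun i hi => by simp [he i hi, hw.1 i hi]
  refine ⟨r' + (L₀ + 1) • w, R.add_mem hr' (R.smul_mem _ hwR), fun i hi => ?_, fun i hi => ?_, ?_⟩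
  · have h1 := abs_le.mp (hb i hi)
    have h2 := hw.2 i hi
    have h3 := h2.2.trans (le_abs_self C)
    simp only [Pi.add_apply, Pi.smul_apply, smul_eq_mul]
    constructor <;> nlinarith
  · rw [hoff i hi]; exact hr0 i hi
  · exact (Finset.sum_congr rfl fun i hi => hoff i (by simpa using hi)).trans hr1

/-- Dirichlet approximations of a multiple of `p` from below, with small total error and the same
support as `p`; they stay valid in a neighbourhood of `p`. -/
theorem exists_nhds_approx {n : ℕ} (p : Fin n → ℝ) (hp : ∀ i, 0 ≤ p i) :
    ∃ (m : Fin n → ℤ) (s : ℝ), (∀ i, 0 ≤ m i) ∧ (∀ i, 0 < p i → 1 ≤ m i) ∧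
      ∀ᶠ q in nhds p, (∀ i, 0 ≤ q i) → (∀ i, (m i : ℝ) ≤ s * q i) ∧ ∑ i, (s * q i - m i) < 1 := by
  obtain ⟨δ, hδ, hδ1, hδp⟩ : ∃ δ : ℝ, 0 < δ ∧ δ ≤ 1 ∧ ∀ i, 0 < p i → δ ≤ p i := by
    have h : ∀ᶠ δ : ℝ in nhdsWithin 0 (Ioi 0), ∀ i, 0 < p i → δ ≤ p i := by
      rw [Filter.eventually_all]
      intro i
      by_cases h : 0 < p i
      · filter_upwards [Ioo_mem_nhdsGT h] with δ hδ _ using hδ.2.le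
      · exact Filter.Eventually.of_forall fun _ h' => absurd h' h
    obtain ⟨δ, ⟨h1, h2⟩, h3⟩ := ((h.and (Ioo_mem_nhdsGT zero_lt_one)).and
      self_mem_nhdsWithin).exists
    exact ⟨δ, h3, h2.2.le, h1⟩
  have hsum : 0 ≤ ∑ i, p i := Finset.sum_nonneg fun i _ => hp i
  set t : ℝ := 1 / (3 * (1 + ∑ i, p i)) with ht
  have htpos : 0 < t := by positivity
  have htsum : t * ∑ i, p i < 1 / 2 := by
    rw [ht, one_div, inv_mul_lt_iff₀ (by positivity)]
    linarith
  have ht1 : t ≤ 1 := by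
    rw [ht, div_le_one (by positivity)]; linarith
  set ε : ℝ := t * δ / (2 * (n + 1)) with hε
  have hεpos : 0 < ε := by positivity
  have hnε : (n + 1) * ε ≤ 1 / 2 := by
    have : (n + 1) * ε = t * δ / 2 := by rw [hε]; field_simp
    rw [this]; nlinarith
  have hεt : ε < t * δ := by
    rw [hε, div_lt_iff₀ (by positivity)]
    have : (0 : ℝ) ≤ n := by positivity
    nlinarith [mul_pos htpos hδ, mul_nonneg this (mul_pos htpos hδ).le]
  have hεδ : ε < δ := hεt.trans_le (by nlinarith)
  obtain ⟨N₀, hN₀⟩ := exists_simultaneous_approx_s1 n hεpos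
  obtain ⟨N, hN1, -, m, hm⟩ := hN₀ p
  have hN : (1 : ℝ) ≤ N := by exact_mod_cast hN1
  have hm0 : ∀ i, ¬ 0 < p i → m i = 0 := by
    intro i hi
    have h0 : p i = 0 := le_antisymm (not_lt.mp hi) (hp i)
    have := hm i
    rw [h0, mul_zero, zero_sub, abs_neg] at this
    have h2 : |(m i : ℝ)| < 1 := by linarith
    rw [← Int.cast_abs] at h2
    exact Int.abs_lt_one_iff.mp (by exact_mod_cast h2)
  have hm1 : ∀ i, 0 < p i → 1 ≤ m i := by
    intro i hi
    have h := (abs_le.mp (hm i)).2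
    have : (0 : ℝ) < m i := by nlinarith [hδp i hi]
    exact_mod_cast this
  refine ⟨m, N + t, fun i => ?_, hm1, ?_⟩
  · by_cases hi : 0 < p i
    · exact zero_le_one.trans (hm1 i hi)
    · exact (hm0 i hi).ge
  · have h1 : ∀ i, ∀ᶠ q in nhds p, 0 ≤ q i → (m i : ℝ) ≤ (N + t) * q i := by
      intro i
      by_cases hi : 0 < p i
      · have hlt : (m i : ℝ) < (N + t) * p i := by
          have h := (abs_le.mp (hm i)).1
          nlinarith [hδp i hi]
        have hc : Continuous fun q : Fin n → ℝ => (N + t) * q i := by fun_prop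
        filter_upwards [hc.continuousAt.eventually_const_lt hlt] with q hq _ using hq.le
      · filter_upwards with q hq
        rw [hm0 i hi]
        simp only [Int.cast_zero]
        positivity
    have h2 : ∑ i, ((N + t) * p i - m i) < 1 := by
      calc ∑ i, ((N + t) * p i - m i) = t * ∑ i, p i + ∑ i, (N * p i - m i) := by
            rw [Finset.mul_sum, ← Finset.sum_add_distrib]
            exact Finset.sum_congr rfl fun i _ => by ring
        _ ≤ t * ∑ i, p i + ∑ _i : Fin n, ε := by
            gcongr with i
            exact (abs_le.mp (hm i)).2
        _ < 1 := by simp; linarith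
    have hc : Continuous fun q : Fin n → ℝ => ∑ i, ((N + t) * q i - m i) := by fun_prop
    filter_upwards [hc.continuousAt.eventually_lt_const h2, Filter.eventually_all.mpr h1]
      with q hq hq' h0 using ⟨fun i => hq' i (h0 i), hq⟩

theorem LatticeFree.exists_larger_support {n : ℕ} (T : Finset (Fin n)) (C : ℝ) :
    ∃ C' : ℝ, ∀ R : Submodule ℝ (Fin n → ℝ), LatticeFree R →
      (∃ w ∈ R, BoundedOn T C w) → (∃ r ∈ R, (∀ i ∉ T, 0 ≤ r i) ∧ ∑ i ∈ Tᶜ, r i = 1) →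
      ∃ T' : Finset (Fin n), T ⊂ T' ∧ ∃ w ∈ R, BoundedOn T' C' w := by
  obtain ⟨L₁, hL₁⟩ := LatticeFree.exists_bounded_extension T C
  set K : Set (Fin n → ℝ) := {p | (∀ i ∈ T, 1 ≤ p i ∧ p i ≤ L₁) ∧ (∀ i ∉ T, 0 ≤ p i) ∧
    ∑ i ∈ Tᶜ, p i = 1} with hK
  have hK0 : ∀ p ∈ K, ∀ i, 0 ≤ p i := by
    intro p hp i
    by_cases hi : i ∈ T
    · linarith [hp.1 i hi]
    · exact hp.2.1 i hi
  have hKc : IsCompact K := by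
    refine Metric.isCompact_of_isClosed_isBounded ?_ ?_
    · have h1 : IsClosed {p : Fin n → ℝ | ∀ i ∈ T, 1 ≤ p i ∧ p i ≤ L₁} := by
        simp only [ofPred_forall]
        exact isClosed_biInter fun i _ => isClosed_Icc.preimage (continuous_apply i)
      have h2 : IsClosed {p : Fin n → ℝ | ∀ i ∉ T, 0 ≤ p i} := by
        simp only [ofPred_forall]
        exact isClosed_iInter fun i => isClosed_iInter fun _ =>
          isClosed_le (by fun_prop) (by fun_prop)
      have h3 : IsClosed {p : Fin n → ℝ | ∑ i ∈ Tᶜ, p i = 1} :=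
        isClosed_eq (by fun_prop) (by fun_prop)
      exact h1.inter (h2.inter h3)
    · refine (Metric.isBounded_Icc (0 : Fin n → ℝ) (fun _ => max L₁ 1)).subset ?_
      intro p hp
      refine ⟨hK0 p hp, fun i => ?_⟩
      by_cases hi : i ∈ T
      · exact (hp.1 i hi).2.trans (le_max_left _ _)
      · refine le_trans ?_ (le_max_right _ _)
        rw [← hp.2.2]
        exact Finset.single_le_sum (f := p) (fun j _ => hK0 p hp j) (by simpa using hi)
  have hcov : ∃ C' : ℝ, ∀ q ∈ K, ∃ (m : Fin n → ℤ) (s : ℝ), (∀ i, 0 ≤ m i ∧ (m i : ℝ) ≤ C') ∧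
      (∀ i ∈ T, 1 ≤ m i) ∧ (∃ i ∉ T, 1 ≤ m i) ∧
      (∀ i, (m i : ℝ) ≤ s * q i) ∧ ∑ i, (s * q i - m i) < 1 := by
    refine hKc.induction_on (p := fun S => ∃ C' : ℝ, ∀ q ∈ S, ∃ (m : Fin n → ℤ) (s : ℝ),
      (∀ i, 0 ≤ m i ∧ (m i : ℝ) ≤ C') ∧ (∀ i ∈ T, 1 ≤ m i) ∧ (∃ i ∉ T, 1 ≤ m i) ∧
      (∀ i, (m i : ℝ) ≤ s * q i) ∧ ∑ i, (s * q i - m i) < 1) ?_ ?_ ?_ ?_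
    · exact ⟨0, by simp⟩
    · rintro S S' hS ⟨C', h⟩
      exact ⟨C', fun q hq => h q (hS hq)⟩
    · rintro S S' ⟨C₁, h₁⟩ ⟨C₂, h₂⟩
      refine ⟨max C₁ C₂, ?_⟩
      rintro q (hq | hq)
      · obtain ⟨m, s, hm, h⟩ := h₁ q hq
        exact ⟨m, s, fun i => ⟨(hm i).1, (hm i).2.trans (le_max_left _ _)⟩, h⟩
      · obtain ⟨m, s, hm, h⟩ := h₂ q hq
        exact ⟨m, s, fun i => ⟨(hm i).1, (hm i).2.trans (le_max_right _ _)⟩, h⟩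
    · intro p hp
      obtain ⟨m, s, hm0, hm1, hev⟩ := exists_nhds_approx p (hK0 p hp)
      refine ⟨K ∩ {q | (∀ i, 0 ≤ q i) → (∀ i, (m i : ℝ) ≤ s * q i) ∧ ∑ i, (s * q i - m i) < 1},
        Filter.inter_mem self_mem_nhdsWithin (mem_nhdsWithin_of_mem_nhds hev),
        ∑ i, (m i : ℝ), fun q hq => ⟨m, s, fun i => ⟨hm0 i, ?_⟩, fun i hi => ?_, ?_,
          hq.2 (hK0 q hq.1)⟩⟩
      · exact Finset.single_le_sum (f := fun i => (m i : ℝ))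
          (fun j _ => by exact_mod_cast hm0 j) (Finset.mem_univ i)
      · exact hm1 i (by linarith [hp.1 i hi])
      · obtain ⟨i, hi, hpi⟩ : ∃ i ∈ Tᶜ, 0 < p i :=
          Finset.exists_lt_of_sum_lt (f := fun _ => (0 : ℝ)) (by rw [hp.2.2]; simp)
        exact ⟨i, by simpa using hi, hm1 i hpi⟩
  obtain ⟨C', hC'⟩ := hcov
  refine ⟨C', fun R hR hw hr => ?_⟩
  obtain ⟨p, hpR, hpK⟩ := hL₁ R hR hw hr
  obtain ⟨m, s, hm, hmT, ⟨j, hjT, hj⟩, hms, hsum⟩ := hC' p hpK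
  refine ⟨Finset.univ.filter fun i => 1 ≤ m i, ?_, fun i => (m i : ℝ), ?_, ?_, ?_⟩
  · rw [Finset.ssubset_iff_of_subset fun i hi => by simpa using hmT i hi]
    exact ⟨j, by simpa using hj, hjT⟩
  · have h := hR (-m) (fun i => s * p i - m i) (fun i => sub_nonneg.mpr (hms i)) hsum (by
      convert R.smul_mem s hpR using 1
      ext i; simp)
    convert R.neg_mem h using 1
    ext i; simp
  · intro i hi
    have h1 := (hm i).1
    have h2 : ¬ 1 ≤ m i := by simpa using hi
    have : m i = 0 := by omega
    simp [this]
  · intro i hi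
    exact ⟨Int.cast_one_le_of_pos (Finset.mem_filter.mp hi).2, (hm i).2⟩

/-- A lattice-free space of coefficient vectors that meets the open positive orthant contains a
positive vector whose coordinates have bounded ratios. -/
theorem LatticeFree.exists_bounded_pos (n : ℕ) :
    ∃ C : ℝ, ∀ R : Submodule ℝ (Fin n → ℝ), LatticeFree R → (∃ r ∈ R, ∀ i, 0 < r i) →
      ∃ w ∈ R, ∀ i, 1 ≤ w i ∧ w i ≤ C := by
  have step : ∀ k : ℕ, k ≤ n → ∃ C : ℝ, ∀ R : Submodule ℝ (Fin n → ℝ), LatticeFree R →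
      (∃ r ∈ R, ∀ i, 0 < r i) →
      ∃ T : Finset (Fin n), k ≤ T.card ∧ ∃ w ∈ R, BoundedOn T C w := by
    intro k
    induction k with
    | zero =>
      exact fun _ => ⟨0, fun R _ _ => ⟨∅, le_rfl, 0, R.zero_mem, fun _ _ => rfl, by simp⟩⟩
    | succ k ih =>
      intro hk
      obtain ⟨C, hC⟩ := ih (by omega)
      choose f hf using fun T : Finset (Fin n) => LatticeFree.exists_larger_support T C
      refine ⟨max C (∑ T, |f T|), fun R hR hr => ?_⟩
      obtain ⟨T, hT, w, hwR, hw⟩ := hC R hR hr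
      by_cases hk' : k + 1 ≤ T.card
      · exact ⟨T, hk', w, hwR, hw.1, fun i hi =>
          ⟨(hw.2 i hi).1, (hw.2 i hi).2.trans (le_max_left _ _)⟩⟩
      · obtain ⟨r, hrR, hr⟩ := hr
        have hne : (Tᶜ).Nonempty := by
          rw [← Finset.card_pos, Finset.card_compl, Fintype.card_fin]; omega
        have hpos : 0 < ∑ i ∈ Tᶜ, r i := Finset.sum_pos (fun i _ => hr i) hne
        obtain ⟨T', hTT', w', hw'R, hw'⟩ := hf T R hR ⟨w, hwR, hw⟩
          ⟨(∑ i ∈ Tᶜ, r i)⁻¹ • r, R.smul_mem _ hrR, fun i _ => by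
            have := (hr i).le
            simp only [Pi.smul_apply, smul_eq_mul]; positivity, by
            simp only [Pi.smul_apply, smul_eq_mul]
            rw [← Finset.mul_sum, inv_mul_cancel₀ hpos.ne']⟩
        refine ⟨T', by have := Finset.card_lt_card hTT'; omega, w', hw'R, hw'.1, fun i hi =>
          ⟨(hw'.2 i hi).1, ((hw'.2 i hi).2.trans (le_abs_self _)).trans ?_⟩⟩
        exact (Finset.single_le_sum (f := fun T => |f T|) (fun _ _ => abs_nonneg _)
          (Finset.mem_univ T)).trans (le_max_right _ _)
  obtain ⟨C, hC⟩ := step n le_rfl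
  refine ⟨C, fun R hR hr => ?_⟩
  obtain ⟨T, hT, w, hwR, hw⟩ := hC R hR hr
  have : T = Finset.univ := by
    rw [← Finset.card_eq_iff_eq_univ, Fintype.card_fin]
    exact le_antisymm ((Finset.card_le_univ T).trans (by simp)) hT
  exact ⟨w, hwR, fun i => hw.2 i (by simp [this])⟩

theorem intVec_eq_zero_iff {d : ℕ} {ν : Fin d → ℤ} : intVec ν = 0 ↔ ν = 0 := by
  simp [funext_iff, intVec]

theorem dotR_add_left {d : ℕ} (x y z : Fin d → ℝ) : dotR (x + y) z = dotR x z + dotR y z :=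
  add_dotProduct x y z

theorem dotR_sub_left {d : ℕ} (x y z : Fin d → ℝ) : dotR (x - y) z = dotR x z - dotR y z :=
  sub_dotProduct x y z

theorem dotR_smul_left {d : ℕ} (c : ℝ) (x y : Fin d → ℝ) : dotR (c • x) y = c * dotR x y :=
  smul_dotProduct c x y

theorem dotR_smul_right {d : ℕ} (c : ℝ) (x y : Fin d → ℝ) : dotR x (c • y) = c * dotR x y :=
  dotProduct_smul c x y

theorem dotR_sub_right {d : ℕ} (x y z : Fin d → ℝ) : dotR x (y - z) = dotR x y - dotR x z :=
  dotProduct_sub x y z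

theorem dotR_sum_smul_right {d : ℕ} {ι : Type*} [Fintype ι] (x : Fin d → ℝ) (c : ι → ℝ)
    (v : ι → Fin d → ℝ) : dotR x (∑ j, c j • v j) = ∑ j, c j * dotR x (v j) := by
  simp only [← dotR_smul_right]
  exact dotProduct_sum x Finset.univ fun j => c j • v j

theorem abs_dotR_le {d : ℕ} (x y : Fin d → ℝ) : |dotR x y| ≤ d * (‖x‖ * ‖y‖) := by
  calc |dotR x y| ≤ ∑ i, |x i * y i| := Finset.abs_sum_le_sum_abs _ _
    _ ≤ ∑ _i : Fin d, ‖x‖ * ‖y‖ := by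
        gcongr with i
        rw [abs_mul]
        exact mul_le_mul (norm_le_pi_norm x i) (norm_le_pi_norm y i) (abs_nonneg _) (norm_nonneg _)
    _ = d * (‖x‖ * ‖y‖) := by simp

theorem continuous_dotR_left {d : ℕ} (y : Fin d → ℝ) : Continuous fun x => dotR x y := by
  unfold dotR; fun_prop

theorem finite_setOf_norm_intVec_le (d : ℕ) (r : ℝ) :
    {ν : Fin d → ℤ | ‖intVec ν‖ ≤ r}.Finite := by
  refine (Set.finite_Icc (fun _ : Fin d => -⌈r⌉) (fun _ => ⌈r⌉)).subset fun ν hν => ?_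
  have h : ∀ i, |ν i| ≤ ⌈r⌉ := fun i => by
    have h1 : |(ν i : ℝ)| ≤ r := (norm_le_pi_norm (intVec ν) i).trans hν
    have h2 : ((|ν i| : ℤ) : ℝ) ≤ ⌈r⌉ := by
      rw [Int.cast_abs]; exact h1.trans (Int.le_ceil r)
    exact_mod_cast h2
  exact ⟨fun i => (abs_le.mp (h i)).1, fun i => (abs_le.mp (h i)).2⟩

theorem exists_linear_growth {d : ℕ} {X : Set (Fin d → ℝ)} (hX : X.Finite)
    (h : ∀ ν : Fin d → ℤ, ν ≠ 0 → ∃ a ∈ X, 1 ≤ dotR a (intVec ν)) :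
    ∃ c : ℝ, 0 < c ∧ ∀ ν : Fin d → ℤ, ν ≠ 0 → ∃ a ∈ X, c * ‖intVec ν‖ ≤ dotR a (intVec ν) := by
  obtain ⟨B, hBpos, hB⟩ : ∃ B : ℝ, 0 < B ∧ ∀ a ∈ X, ‖a‖ ≤ B := hX.isBounded.exists_pos_norm_le
  set ε : ℝ := 1 / (2 * (d * B + 1)) with hε
  have hdB : 0 ≤ d * B := by positivity
  have hεpos : 0 < ε := by positivity
  have hε2 : ε ≤ 1 / 2 := one_div_le_one_div_of_le (by norm_num) (by linarith)
  have hdε : d * B * ε ≤ 1 / 2 := by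
    rw [hε, mul_one_div, div_le_div_iff₀ (by positivity) (by norm_num)]; linarith
  obtain ⟨N₀, hN₀⟩ := exists_simultaneous_approx_s1 d hεpos
  refine ⟨1 / (2 * (N₀ + 1)), by positivity, fun ν hν => ?_⟩
  set r := ‖intVec ν‖ with hr
  have hrpos : 0 < r := norm_pos_iff.mpr (intVec_eq_zero_iff.not.mpr hν)
  obtain ⟨N, hN1, hNN, z, hz⟩ := hN₀ (r⁻¹ • intVec ν)
  have hN : (1 : ℝ) ≤ N := by exact_mod_cast hN1
  have hN' : (N : ℝ) ≤ N₀ := by exact_mod_cast hNN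
  have hzclose : ‖(N : ℝ) • r⁻¹ • intVec ν - intVec z‖ ≤ ε :=
    (pi_norm_le_iff_of_nonneg hεpos.le).mpr hz
  have hz0 : z ≠ 0 := by
    intro h0
    rw [intVec_eq_zero_iff.mpr h0, sub_zero, norm_smul, norm_smul, norm_inv, norm_norm, ← hr,
      inv_mul_cancel₀ hrpos.ne', mul_one, Real.norm_natCast] at hzclose
    linarith
  obtain ⟨a, ha, haz⟩ := h z hz0
  refine ⟨a, ha, ?_⟩
  have h1 := (abs_dotR_le a ((N : ℝ) • r⁻¹ • intVec ν - intVec z)).trans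
    (mul_le_mul_of_nonneg_left (mul_le_mul (hB a ha) hzclose (norm_nonneg _) hBpos.le)
      (Nat.cast_nonneg d))
  rw [dotR_sub_right, dotR_smul_right, dotR_smul_right] at h1
  have h2 := (abs_le.mp h1).1
  have h3 : 1 / 2 ≤ N * (r⁻¹ * dotR a (intVec ν)) := by nlinarith
  have h4 : r / 2 ≤ N * dotR a (intVec ν) := by
    have := mul_le_mul_of_nonneg_left h3 hrpos.le
    field_simp at this
    linarith
  rw [one_div_mul_eq_div, div_le_iff₀ (by positivity)]
  have h5 : 0 ≤ dotR a (intVec ν) := by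
    by_contra! hneg
    nlinarith
  nlinarith

/-- The nonzero integer vectors whose pairing with every point of `X` is at most one. -/
def tightVecs {d : ℕ} (X : Set (Fin d → ℝ)) : Set (Fin d → ℤ) :=
  {ν | ν ≠ 0 ∧ ∀ a ∈ X, dotR a (intVec ν) ≤ 1}

theorem finite_tightVecs {d : ℕ} {X : Set (Fin d → ℝ)} (hX : X.Finite)
    (h : ∀ ν : Fin d → ℤ, ν ≠ 0 → ∃ a ∈ X, 1 ≤ dotR a (intVec ν)) : (tightVecs X).Finite := by
  obtain ⟨c, hc, hgrow⟩ := exists_linear_growth hX h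
  refine (finite_setOf_norm_intVec_le d (1 / c)).subset fun ν hν => ?_
  obtain ⟨a, ha, hac⟩ := hgrow ν hν.1
  have := hac.trans (hν.2 a ha)
  change ‖intVec ν‖ ≤ 1 / c
  rw [le_div_iff₀ hc]; linarith

theorem exists_tightVecs_dotR_neg {d : ℕ} {X : Set (Fin d → ℝ)} (hX : X.Finite)
    (h : ∀ ν : Fin d → ℤ, ν ≠ 0 → ∃ a ∈ X, 1 ≤ dotR a (intVec ν))
    (h' : ∀ x : Fin d → ℝ, x ≠ 0 → ∃ ν : Fin d → ℤ, ν ≠ 0 ∧ ∀ a ∈ X, dotR (a + x) (intVec ν) < 1)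
    {x : Fin d → ℝ} (hx : x ≠ 0) : ∃ ν ∈ tightVecs X, dotR x (intVec ν) < 0 := by
  by_contra! hcon
  obtain ⟨c, hc, hgrow⟩ := exists_linear_growth hX h
  have hev : ∀ᶠ ε : ℝ in nhdsWithin 0 (Ioi 0), ∀ ν ∈ {ν : Fin d → ℤ | ‖intVec ν‖ ≤ 2 / c},
      ν ≠ 0 → ∃ a ∈ X, 1 ≤ dotR (a + ε • x) (intVec ν) := by
    rw [Filter.eventually_all_finite (finite_setOf_norm_intVec_le d (2 / c))]
    intro ν _
    by_cases hν : ν ∈ tightVecs X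
    · filter_upwards [self_mem_nhdsWithin] with ε hε hν0
      obtain ⟨a, ha, ha1⟩ := h ν hν0
      refine ⟨a, ha, ?_⟩
      rw [dotR_add_left, dotR_smul_left]
      have := mul_nonneg (le_of_lt hε) (hcon ν hν)
      linarith
    · by_cases hν0 : ν = 0
      · exact Filter.Eventually.of_forall fun _ h0 => absurd hν0 h0
      · have : ∃ a ∈ X, 1 < dotR a (intVec ν) := by
          by_contra! hle
          exact hν ⟨hν0, hle⟩
        obtain ⟨a, ha, ha1⟩ := this
        have hcont : Continuous fun ε : ℝ => dotR (a + ε • x) (intVec ν) :=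
          (continuous_dotR_left _).comp (by fun_prop)
        have hlt : 1 < dotR (a + (0 : ℝ) • x) (intVec ν) := by simpa using ha1
        filter_upwards [mem_nhdsWithin_of_mem_nhds
          (hcont.continuousAt.eventually_const_lt hlt)] with ε hε _ using ⟨a, ha, le_of_lt hε⟩
  have hpos : 0 < c / (2 * (d * ‖x‖ + 1)) := by positivity
  obtain ⟨ε, ⟨hε, hεlt⟩, hεpos⟩ :=
    ((hev.and (Ioo_mem_nhdsGT hpos)).and self_mem_nhdsWithin).exists
  have hε0 : 0 < ε := hεpos
  have hεc : ε * (d * ‖x‖) ≤ c / 2 := by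
    have := hεlt.2
    rw [lt_div_iff₀ (by positivity)] at this
    nlinarith
  obtain ⟨ν, hν0, hν⟩ := h' (ε • x) (smul_ne_zero hε0.ne' hx)
  have hmem : ‖intVec ν‖ ≤ 2 / c := by
    obtain ⟨a, ha, hac⟩ := hgrow ν hν0
    have h1 := hν a ha
    rw [dotR_add_left, dotR_smul_left] at h1
    have h2 := mul_le_mul_of_nonneg_left (abs_dotR_le x (intVec ν)) hε0.le
    have h3 := mul_le_mul_of_nonneg_left (neg_abs_le (dotR x (intVec ν))) hε0.le
    have h4 := mul_le_mul_of_nonneg_right hεc (norm_nonneg (intVec ν))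
    rw [le_div_iff₀ hc]
    nlinarith
  obtain ⟨a, ha, ha1⟩ := hε ν hmem hν0
  exact absurd (hν a ha) (not_lt.mpr ha1)

/-- If no nonzero linear functional is nonnegative on the finite set `W`, then the convex hull of
`W` contains a positive multiple of every vector. -/
theorem exists_smul_mem_convexHull {d : ℕ} (hd : 0 < d) {W : Set (Fin d → ℝ)} (hW : W.Finite)
    (h : ∀ x : Fin d → ℝ, x ≠ 0 → ∃ v ∈ W, dotR x v < 0) (y : Fin d → ℝ) :
    ∃ t : ℝ, 0 < t ∧ t • y ∈ convexHull ℝ W := by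
  have hd' : (0 : ℝ) < d := by exact_mod_cast hd
  obtain ⟨r, hr, hrW⟩ : ∃ r : ℝ, 0 < r ∧ ∀ x ∈ Metric.sphere (0 : Fin d → ℝ) 1,
      ∃ v ∈ W, dotR x v ≤ -r := by
    refine (isCompact_sphere (0 : Fin d → ℝ) 1).induction_on
      (p := fun S => ∃ r : ℝ, 0 < r ∧ ∀ x ∈ S, ∃ v ∈ W, dotR x v ≤ -r) ⟨1, one_pos, by simp⟩
      ?_ ?_ ?_
    · rintro S S' hS ⟨r, hr, h⟩
      exact ⟨r, hr, fun x hx => h x (hS hx)⟩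
    · rintro S S' ⟨r, hr, h₁⟩ ⟨s, hs, h₂⟩
      refine ⟨min r s, lt_min hr hs, ?_⟩
      rintro x (hx | hx)
      · obtain ⟨v, hv, hxv⟩ := h₁ x hx
        exact ⟨v, hv, hxv.trans (neg_le_neg (min_le_left r s))⟩
      · obtain ⟨v, hv, hxv⟩ := h₂ x hx
        exact ⟨v, hv, hxv.trans (neg_le_neg (min_le_right r s))⟩
    · intro x hx
      have hx0 : x ≠ 0 := by
        rintro rfl
        simp at hx
      obtain ⟨v, hv, hxv⟩ := h x hx0
      have hlt : dotR x v < dotR x v / 2 := by linarith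
      refine ⟨{x' | dotR x' v < dotR x v / 2}, mem_nhdsWithin_of_mem_nhds
        ((continuous_dotR_left v).continuousAt.eventually_lt_const hlt), -(dotR x v / 2),
        by linarith, fun x' hx' => ⟨v, hv, ?_⟩⟩
      rw [neg_neg]
      exact le_of_lt hx'
  have hpos : 0 < d * (‖y‖ + 1) := by positivity
  refine ⟨r / (d * (‖y‖ + 1)), by positivity, ?_⟩
  by_contra hmem
  obtain ⟨f, u, hfu, hfW⟩ := geometric_hahn_banach_point_closed (convex_convexHull ℝ W)
    (hW.isClosed_convexHull ℝ) hmem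
  set x : Fin d → ℝ := fun i => f (Pi.single i 1) with hxdef
  have hfx : ∀ z, f z = dotR x z := by
    intro z
    conv_lhs => rw [← Finset.univ_sum_single z]
    rw [map_sum]
    refine Finset.sum_congr rfl fun i _ => ?_
    have : (Pi.single i (z i) : Fin d → ℝ) = z i • Pi.single i 1 := by
      rw [← Pi.single_smul, smul_eq_mul, mul_one]
    rw [this, map_smul, smul_eq_mul, mul_comm]
  have hsep : ∀ v ∈ W, dotR x ((r / (d * (‖y‖ + 1))) • y) < dotR x v := fun v hv => by
    rw [← hfx, ← hfx]
    exact hfu.trans (hfW v (subset_convexHull ℝ W hv))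
  have hx0 : x ≠ 0 := by
    intro h0
    obtain ⟨v, hv, -⟩ := h (Pi.single ⟨0, hd⟩ 1) (by simp)
    have := hsep v hv
    rw [h0] at this
    simp [dotR] at this
  have hxn : 0 < ‖x‖ := norm_pos_iff.mpr hx0
  obtain ⟨v, hv, hxv⟩ := hrW (‖x‖⁻¹ • x) (by
    rw [mem_sphere_zero_iff_norm, norm_smul, norm_inv, norm_norm, inv_mul_cancel₀ hxn.ne'])
  rw [dotR_smul_left, inv_mul_le_iff₀ hxn] at hxv
  have h1 := hsep v hv
  rw [dotR_smul_right] at h1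
  have h2 := (abs_le.mp (abs_dotR_le x y)).1
  have h3 := mul_le_mul_of_nonneg_left h2 (show 0 ≤ r / (d * (‖y‖ + 1)) by positivity)
  have h4 : r / (d * (‖y‖ + 1)) * (d * (‖x‖ * ‖y‖)) ≤ ‖x‖ * r := by
    rw [div_mul_eq_mul_div, div_le_iff₀ hpos]
    have : 0 ≤ r * (d * ‖x‖) := by positivity
    nlinarith
  linarith

open scoped NNReal in
/-- A subset whose convex hull contains a positive multiple of every vector contains boundedly many
vectors that span the whole space with nonnegative coefficients. -/
theorem exists_family_span_nnreal_eq_top {d : ℕ} (hd : 0 < d) {W : Set (Fin d → ℝ)}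
    (h : ∀ y : Fin d → ℝ, ∃ t : ℝ, 0 < t ∧ t • y ∈ convexHull ℝ W) :
    ∃ v : Fin (2 * d * (d + 1)) → Fin d → ℝ, (∀ j, v j ∈ W) ∧
      Submodule.span ℝ≥0 (Set.range v) = ⊤ := by
  classical
  have hdir : ∀ k : Fin d × Bool, ∃ s : Finset (Fin d → ℝ), ↑s ⊆ W ∧ s.card ≤ d + 1 ∧
      ∃ t : ℝ, 0 < t ∧ t • (Pi.single k.1 (if k.2 then 1 else -1) : Fin d → ℝ) ∈
        convexHull ℝ (s : Set (Fin d → ℝ)) := by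
    intro k
    obtain ⟨t, ht, hmem⟩ := h (Pi.single k.1 (if k.2 then 1 else -1))
    rw [convexHull_eq_union] at hmem
    simp only [mem_iUnion] at hmem
    obtain ⟨s, hs, hai, hmem⟩ := hmem
    refine ⟨s, hs, ?_, t, ht, hmem⟩
    simpa using hai.card_le_finrank_succ.trans
      (Nat.succ_le_succ (Submodule.finrank_le _))
  choose s hsW hscard t ht hts using hdir
  set U : Finset (Fin d → ℝ) := Finset.univ.biUnion s with hU
  have hUcard : U.card ≤ 2 * d * (d + 1) := by
    refine (Finset.card_biUnion_le_card_mul _ _ (d + 1) fun k _ => hscard k).trans_eq ?_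
    simp [mul_comm d 2]
  have hsU : ∀ k, s k ⊆ U := fun k => Finset.subset_biUnion_of_mem s (Finset.mem_univ k)
  have hUW : ↑U ⊆ W := by
    intro x hx
    obtain ⟨k, -, hk⟩ := Finset.mem_biUnion.mp hx
    exact hsW k hk
  have hspan : Submodule.span ℝ≥0 (U : Set (Fin d → ℝ)) = ⊤ := by
    have hconv : ∀ k, convexHull ℝ (s k : Set (Fin d → ℝ)) ⊆
        (Submodule.span ℝ≥0 (U : Set (Fin d → ℝ)) : Set (Fin d → ℝ)) := by
      intro k
      refine convexHull_min (fun x hx => Submodule.subset_span (hsU k hx)) ?_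
      intro x hx y hy a b ha hb _
      exact Submodule.add_mem _ (Submodule.smul_mem _ (⟨a, ha⟩ : ℝ≥0) hx)
        (Submodule.smul_mem _ (⟨b, hb⟩ : ℝ≥0) hy)
    have hsingle : ∀ k : Fin d × Bool, ∀ c : ℝ, 0 ≤ c →
        (Pi.single k.1 (if k.2 then c else -c) : Fin d → ℝ) ∈
          Submodule.span ℝ≥0 (U : Set (Fin d → ℝ)) := by
      intro k c hc
      have e : (Pi.single k.1 (if k.2 then c else -c) : Fin d → ℝ) =
          (c / t k) • t k • Pi.single k.1 (if k.2 then 1 else -1) := by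
        rw [smul_smul, div_mul_cancel₀ _ (ht k).ne', ← Pi.single_smul]
        congr 1
        split_ifs <;> simp
      rw [e]
      exact Submodule.smul_mem _ (⟨c / t k, div_nonneg hc (ht k).le⟩ : ℝ≥0) (hconv k (hts k))
    rw [eq_top_iff]
    intro y _
    rw [← Finset.univ_sum_single y]
    refine Submodule.sum_mem _ fun i _ => ?_
    rcases le_total 0 (y i) with hy | hy
    · simpa using hsingle (i, true) (y i) hy
    · simpa using hsingle (i, false) (-y i) (by linarith)
  have hUne : U.Nonempty := by
    obtain ⟨x, hx⟩ := convexHull_nonempty_iff.mp ⟨_, hts (⟨0, hd⟩, true)⟩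
    exact ⟨x, hsU _ hx⟩
  obtain ⟨x₀, hx₀⟩ := hUne
  have : Nonempty U := ⟨⟨x₀, hx₀⟩⟩
  obtain ⟨e⟩ : Nonempty (U ↪ Fin (2 * d * (d + 1))) :=
    Function.Embedding.nonempty_of_card_le (by simpa using hUcard)
  refine ⟨fun j => (Function.invFun e j : U), fun j => hUW (Function.invFun e j).2, ?_⟩
  rw [← hspan]
  congr 1
  ext x
  constructor
  · rintro ⟨j, rfl⟩
    exact (Function.invFun e j).2
  · intro hx
    exact ⟨e ⟨x, hx⟩, by simp [Function.leftInverse_invFun e.injective ⟨x, hx⟩]⟩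

/-- Integer points `ν ≠ 0` of the form `∑ y_j v_j` with `y ≥ 0` and `∑ y_j < 1` would contradict the
hypothesis on `X`, so the linear relations between tight vectors are lattice-free. -/
theorem latticeFree_relations {d n : ℕ} {X : Set (Fin d → ℝ)}
    (h : ∀ ν : Fin d → ℤ, ν ≠ 0 → ∃ a ∈ X, 1 ≤ dotR a (intVec ν))
    {v : Fin n → Fin d → ℤ} (hv : ∀ j, v j ∈ tightVecs X) :
    LatticeFree (LinearMap.ker (Fintype.linearCombination ℝ fun j => intVec (v j))) := by
  intro z y hy hy1 hyz
  have hz : Fintype.linearCombination ℝ (fun j => intVec (v j)) (fun j => (z j : ℝ)) =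
      intVec (∑ j, z j • v j) := by
    rw [Fintype.linearCombination_apply]
    ext i
    simp [intVec, Finset.sum_apply]
  rw [LinearMap.mem_ker, map_sub, sub_eq_zero] at hyz
  rw [LinearMap.mem_ker, hz, intVec_eq_zero_iff]
  by_contra hne
  obtain ⟨a, ha, ha1⟩ := h _ hne
  rw [← hz, ← hyz, Fintype.linearCombination_apply, dotR_sum_smul_right] at ha1
  have : ∑ j, y j * dotR a (intVec (v j)) ≤ ∑ j, y j := by
    gcongr with j
    exact mul_le_of_le_one_right (hy j) ((hv j).2 a ha)
  linarith

open scoped NNReal in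
theorem exists_pos_relation {d n : ℕ} {v : Fin n → Fin d → ℝ}
    (hv : Submodule.span ℝ≥0 (Set.range v) = ⊤) :
    ∃ r ∈ LinearMap.ker (Fintype.linearCombination ℝ v), ∀ i, 0 < r i := by
  obtain ⟨c, hc⟩ := (Submodule.mem_span_range_iff_exists_fun ℝ≥0).mp
    (hv ▸ Submodule.mem_top : -∑ j, v j ∈ Submodule.span ℝ≥0 (Set.range v))
  refine ⟨fun j => c j + 1, ?_, fun j => by positivity⟩
  rw [LinearMap.mem_ker, Fintype.linearCombination_apply]
  simp only [add_smul, one_smul, Finset.sum_add_distrib]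
  have : ∑ j, (c j : ℝ) • v j = -∑ j, v j := hc
  rw [this, neg_add_cancel]

theorem exists_fin_linearIndependent {d : ℕ} {ι : Type*} {v : ι → Fin d → ℝ}
    (hv : Submodule.span ℝ (Set.range v) = ⊤) :
    ∃ f : Fin d → ι, LinearIndependent ℝ (v ∘ f) := by
  obtain ⟨κ, g, -, hspan, hli⟩ := exists_linearIndependent' ℝ v
  rw [hv] at hspan
  let b := Module.Basis.mk hli hspan.ge
  have e : Fin d ≃ κ := (Pi.basisFun ℝ (Fin d)).indexEquiv b
  exact ⟨g ∘ e, hli.comp e e.injective⟩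

/-- The boundedness statement behind the finiteness theorem: the tight vectors at an isolated point
of the Fine interior contain a basis whose pairings with `X` are bounded in terms of `d` alone. -/
theorem exists_bounded_pairing (d : ℕ) (hd : 0 < d) :
    ∃ D : ℝ, ∀ X : Set (Fin d → ℝ), X.Finite →
      (∀ ν : Fin d → ℤ, ν ≠ 0 → ∃ a ∈ X, 1 ≤ dotR a (intVec ν)) →
      (∀ x : Fin d → ℝ, x ≠ 0 → ∃ ν : Fin d → ℤ, ν ≠ 0 ∧ ∀ a ∈ X, dotR (a + x) (intVec ν) < 1) →
      ∃ v : Fin d → Fin d → ℤ, LinearIndependent ℝ (fun j => intVec (v j)) ∧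
        ∀ a ∈ X, ∀ j, |dotR a (intVec (v j))| ≤ D := by
  set n := 2 * d * (d + 1) with hn
  obtain ⟨C, hC⟩ := LatticeFree.exists_bounded_pos n
  refine ⟨max 1 (n * |C|), fun X hX h h' => ?_⟩
  obtain ⟨u, hu, huspan⟩ := exists_family_span_nnreal_eq_top hd
    (exists_smul_mem_convexHull hd ((finite_tightVecs hX h).image intVec) fun x hx => by
      simpa using exists_tightVecs_dotR_neg hX h h' hx)
  choose v hv hvu using hu
  obtain rfl : (fun j => intVec (v j)) = u := funext hvu
  obtain ⟨w, hwR, hw⟩ := hC _ (latticeFree_relations h hv) (exists_pos_relation huspan)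
  have hspan : Submodule.span ℝ (Set.range fun j => intVec (v j)) = ⊤ := by
    rw [eq_top_iff]
    intro x _
    exact Submodule.span_le_restrictScalars NNReal ℝ _ (huspan ▸ Submodule.mem_top)
  obtain ⟨f, hf⟩ := exists_fin_linearIndependent hspan
  refine ⟨v ∘ f, hf, fun a ha j => ?_⟩
  suffices H : ∀ i, |dotR a (intVec (v i))| ≤ max 1 (n * |C|) from H (f j)
  intro i
  have hup : ∀ k, dotR a (intVec (v k)) ≤ 1 := fun k => (hv k).2 a ha
  have hsum : ∑ k, w k * dotR a (intVec (v k)) = 0 := by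
    rw [← dotR_sum_smul_right, ← Fintype.linearCombination_apply, LinearMap.mem_ker.mp hwR]
    simp [dotR]
  rw [← Finset.add_sum_erase _ _ (Finset.mem_univ i)] at hsum
  have hrest : ∑ k ∈ Finset.univ.erase i, w k * dotR a (intVec (v k)) ≤ n * |C| := by
    calc ∑ k ∈ Finset.univ.erase i, w k * dotR a (intVec (v k))
        ≤ ∑ _k ∈ Finset.univ.erase i, |C| := by
          gcongr with k
          have h1 := hw k
          have h2 := h1.2.trans (le_abs_self C)
          nlinarith [hup k]
      _ = (n - 1 : ℕ) * |C| := by simp [hn]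
      _ ≤ n * |C| := by gcongr; omega
  rw [abs_le]
  refine ⟨?_, (hup i).trans (le_max_left _ _)⟩
  have hlow : -(n * |C|) ≤ dotR a (intVec (v i)) := by
    have hpos : 0 ≤ n * |C| := by positivity
    by_contra! hneg
    nlinarith [(hw i).1]
  exact (neg_le_neg (le_max_right _ _)).trans hlow

/-- The lattice `ℤ^d` as an additive subgroup of `ℝ^d`. -/
def latticeSubgroup (d : ℕ) : AddSubgroup (Fin d → ℝ) where
  carrier := latticePts d
  zero_mem' := ⟨0, intVec_eq_zero_iff.mpr rfl⟩
  add_mem' := by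
    rintro _ _ ⟨x, rfl⟩ ⟨y, rfl⟩
    exact ⟨x + y, by ext i; simp [intVec]⟩
  neg_mem' := by
    rintro _ ⟨x, rfl⟩
    exact ⟨-x, by ext i; simp [intVec]⟩

/-- The image of the lattice `ℤ^d` under a linear automorphism of `ℝ^d`. -/
def imageLattice {d : ℕ} (L : (Fin d → ℝ) ≃ₗ[ℝ] (Fin d → ℝ)) : AddSubgroup (Fin d → ℝ) :=
  (latticeSubgroup d).map (L : (Fin d → ℝ) →+ (Fin d → ℝ))

theorem mem_imageLattice {d : ℕ} {L : (Fin d → ℝ) ≃ₗ[ℝ] (Fin d → ℝ)} {y : Fin d → ℝ} :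
    y ∈ imageLattice L ↔ ∃ x ∈ latticePts d, L x = y :=
  Iff.rfl

/-- Lattices containing a common bounded spanning set are compared on a bounded region. -/
theorem addSubgroup_le_of_bounded {d : ℕ} {D : ℝ} {Λ₁ Λ₂ : AddSubgroup (Fin d → ℝ)}
    (hΛ : Λ₁ ≤ latticeSubgroup d) {S : Set (Fin d → ℤ)} (h₁ : ∀ z ∈ S, intVec z ∈ Λ₁)
    (h₂ : ∀ z ∈ S, intVec z ∈ Λ₂) (hS : ∀ z ∈ S, ‖intVec z‖ ≤ D)
    (hspan : Submodule.span ℝ (intVec '' S) = ⊤)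
    (h : ∀ z, ‖intVec z‖ ≤ d * D → intVec z ∈ Λ₁ → intVec z ∈ Λ₂) : Λ₁ ≤ Λ₂ := by
  rw [image_eq_range] at hspan
  obtain ⟨f, hf⟩ := exists_fin_linearIndependent hspan
  have hb0 : ⊤ ≤ Submodule.span ℝ (Set.range ((fun z : S => intVec (z : Fin d → ℤ)) ∘ f)) :=
    (hf.span_eq_top_of_card_eq_finrank' (by simp)).ge
  set b := Module.Basis.mk hf hb0 with hb
  have hbj : ∀ j, b j = intVec (f j : Fin d → ℤ) := fun j => by simp [hb]
  intro y hy
  have hfl : ∀ Λ : AddSubgroup (Fin d → ℝ), (∀ z ∈ S, intVec z ∈ Λ) →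
      ∑ j, ⌊b.repr y j⌋ • b j ∈ Λ := fun Λ hΛ => by
    refine Λ.sum_mem fun j _ => Λ.zsmul_mem ?_ _
    rw [hbj]
    exact hΛ _ (f j).2
  have hdiff : y - ∑ j, ⌊b.repr y j⌋ • b j = ∑ j, Int.fract (b.repr y j) • b j := by
    conv_lhs => rw [← b.sum_repr y]
    rw [← Finset.sum_sub_distrib]
    refine Finset.sum_congr rfl fun j _ => ?_
    rw [b.sum_repr, ← Int.cast_smul_eq_zsmul ℝ, ← sub_smul, Int.self_sub_floor]
  have hnorm : ‖y - ∑ j, ⌊b.repr y j⌋ • b j‖ ≤ d * D := by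
    rw [hdiff]
    calc ‖∑ j, Int.fract (b.repr y j) • b j‖ ≤ ∑ j, ‖Int.fract (b.repr y j) • b j‖ :=
          norm_sum_le _ _
      _ ≤ ∑ _j : Fin d, D := by
          gcongr with j
          rw [norm_smul, Real.norm_of_nonneg (Int.fract_nonneg _)]
          refine (mul_le_of_le_one_left (norm_nonneg _) (Int.fract_lt_one _).le).trans ?_
          rw [hbj]
          exact hS _ (f j).2
      _ = d * D := by simp
  have hmem : y - ∑ j, ⌊b.repr y j⌋ • b j ∈ Λ₁ := Λ₁.sub_mem hy (hfl Λ₁ h₁)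
  obtain ⟨z, hz⟩ := hΛ hmem
  rw [← hz] at hmem hnorm
  have := Λ₂.add_mem (h z hnorm hmem) (hfl Λ₂ h₂)
  rwa [hz, sub_add_cancel] at this

/-- `k` records the vertices of `P` and the lattice inside a bounded region, in coordinates in which
the lattice is a sublattice of `ℤ^d`. -/
def IsBoundedModel {d : ℕ} (D : ℝ) (P : Set (Fin d → ℝ))
    (k : Set (Fin d → ℤ) × Set (Fin d → ℤ)) : Prop :=
  ∃ (L : (Fin d → ℝ) ≃ₗ[ℝ] (Fin d → ℝ)) (a₀ : Fin d → ℝ), a₀ ∈ latticePts d ∧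
    imageLattice L ≤ latticeSubgroup d ∧
    (fun x => L (x - a₀)) '' P = convexHull ℝ (intVec '' k.1) ∧
    (∀ z ∈ k.1, intVec z ∈ imageLattice L) ∧ (∀ z ∈ k.1, ‖intVec z‖ ≤ D) ∧
    Submodule.span ℝ (intVec '' k.1) = ⊤ ∧
    k.2 = {z | ‖intVec z‖ ≤ d * D ∧ intVec z ∈ imageLattice L}

theorem IsBoundedModel.unimodEquiv {d : ℕ} {D : ℝ} {P₁ P₂ : Set (Fin d → ℝ)}
    {k : Set (Fin d → ℤ) × Set (Fin d → ℤ)} (h₁ : IsBoundedModel D P₁ k)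
    (h₂ : IsBoundedModel D P₂ k) : UnimodEquiv P₁ P₂ := by
  obtain ⟨L₁, a₁, ha₁, hL₁, hP₁, hS₁, hD, hspan, hM₁⟩ := h₁
  obtain ⟨L₂, a₂, ha₂, hL₂, hP₂, hS₂, -, -, hM₂⟩ := h₂
  have hΛ : imageLattice L₁ = imageLattice L₂ := by
    refine le_antisymm
      (addSubgroup_le_of_bounded hL₁ hS₁ hS₂ hD hspan fun z hz hz₁ => ?_)
      (addSubgroup_le_of_bounded hL₂ hS₂ hS₁ hD hspan fun z hz hz₂ => ?_)
    · exact (hM₂ ▸ (hM₁ ▸ ⟨hz, hz₁⟩ : z ∈ k.2) : z ∈ {z | _ ∧ _}).2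
    · exact (hM₁ ▸ (hM₂ ▸ ⟨hz, hz₂⟩ : z ∈ k.2) : z ∈ {z | _ ∧ _}).2
  let φ : (Fin d → ℝ) ≃ᵃ[ℝ] (Fin d → ℝ) := (L₁.trans L₂.symm).toAffineEquiv.trans
    (AffineEquiv.constVAdd ℝ (Fin d → ℝ) (a₂ - L₂.symm (L₁ a₁)))
  have hφ : ∀ x, φ x = L₂.symm (L₁ (x - a₁)) + a₂ := fun x => by
    simp [φ, map_sub]; abel
  have hφ' : ∀ x, L₂ (φ x - a₂) = L₁ (x - a₁) := fun x => by simp [hφ]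
  refine ⟨φ, subset_antisymm ?_ ?_, subset_antisymm ?_ ?_⟩
  · rintro _ ⟨x, hx, rfl⟩
    have : L₁ (x - a₁) ∈ imageLattice L₂ :=
      hΛ ▸ mem_imageLattice.mpr ⟨_, (latticeSubgroup d).sub_mem hx ha₁, rfl⟩
    obtain ⟨w, hw, hwe⟩ := mem_imageLattice.mp this
    rw [hφ, ← hwe, LinearEquiv.symm_apply_apply]
    exact (latticeSubgroup d).add_mem hw ha₂
  · intro y hy
    have : L₂ (y - a₂) ∈ imageLattice L₁ :=
      hΛ ▸ mem_imageLattice.mpr ⟨_, (latticeSubgroup d).sub_mem hy ha₂, rfl⟩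
    obtain ⟨w, hw, hwe⟩ := mem_imageLattice.mp this
    exact ⟨w + a₁, (latticeSubgroup d).add_mem hw ha₁, by simp [hφ, hwe]⟩
  · rintro _ ⟨x, hx, rfl⟩
    have : L₁ (x - a₁) ∈ (fun x => L₂ (x - a₂)) '' P₂ := by
      rw [hP₂, ← hP₁]
      exact ⟨x, hx, rfl⟩
    obtain ⟨y, hy, hye⟩ := this
    have hye' : y - a₂ = φ x - a₂ := L₂.injective (hye.trans (hφ' x).symm)
    rwa [← sub_left_injective hye']
  · intro y hy
    have : L₂ (y - a₂) ∈ (fun x => L₁ (x - a₁)) '' P₁ := by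
      rw [hP₁, ← hP₂]
      exact ⟨y, hy, rfl⟩
    obtain ⟨x, hx, hxe⟩ := this
    refine ⟨x, hx, ?_⟩
    have hxe' : φ x - a₂ = y - a₂ := L₂.injective ((hφ' x).trans hxe)
    exact sub_left_injective hxe'

theorem exists_isBoundedModel {d : ℕ} {D : ℝ} (hD : 0 ≤ D) {A : Set (Fin d → ℝ)}
    (hA : A ⊆ latticePts d) (hfull : IsFullDim (convexHull ℝ A)) {v : Fin d → Fin d → ℤ}
    (hv : LinearIndependent ℝ fun j => intVec (v j))
    (hb : ∀ a ∈ A, ∀ a' ∈ A, ∀ j, |dotR (a - a') (intVec (v j))| ≤ D) :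
    ∃ k : Set (Fin d → ℤ) × Set (Fin d → ℤ), (∀ z ∈ k.1, ‖intVec z‖ ≤ D) ∧
      (∀ z ∈ k.2, ‖intVec z‖ ≤ d * D) ∧ IsBoundedModel D (convexHull ℝ A) k := by
  rw [IsFullDim, affineSpan_convexHull] at hfull
  obtain ⟨a₀, ha₀⟩ : A.Nonempty := by
    rw [← affineSpan_nonempty ℝ, hfull]
    exact ⟨0, trivial⟩
  have hunit : IsUnit (Matrix.of fun j => intVec (v j)) :=
    Matrix.linearIndependent_rows_iff_isUnit.mp hv
  let L : (Fin d → ℝ) ≃ₗ[ℝ] (Fin d → ℝ) := LinearEquiv.ofBijective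
    (Matrix.mulVecLin (Matrix.of fun j => intVec (v j)))
    ⟨Matrix.mulVec_injective_iff_isUnit.mpr hunit, Matrix.mulVec_surjective_iff_isUnit.mpr hunit⟩
  have hL : ∀ x j, L x j = dotR x (intVec (v j)) := fun x j =>
    dotProduct_comm (intVec (v j)) x
  have hLlat : imageLattice L ≤ latticeSubgroup d := by
    rintro _ ⟨_, ⟨x, rfl⟩, rfl⟩
    refine ⟨fun j => ∑ i, x i * v j i, ?_⟩
    ext j
    rw [show (L : (Fin d → ℝ) →+ (Fin d → ℝ)) (intVec x) = L (intVec x) from rfl, hL]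
    simp [intVec, dotR]
  have himg : intVec '' {z : Fin d → ℤ | ∃ a ∈ A, L (a - a₀) = intVec z} =
      (fun x => L (x - a₀)) '' A := by
    ext y
    constructor
    · rintro ⟨z, ⟨a, ha, haz⟩, rfl⟩
      exact ⟨a, ha, haz⟩
    · rintro ⟨a, ha, rfl⟩
      obtain ⟨z, hz⟩ := hLlat (mem_imageLattice.mpr
        ⟨a - a₀, (latticeSubgroup d).sub_mem (hA ha) (hA ha₀), rfl⟩)
      exact ⟨z, ⟨a, ha, hz.symm⟩, hz⟩
  let ψ : (Fin d → ℝ) ≃ᵃ[ℝ] (Fin d → ℝ) :=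
    (AffineEquiv.constVAdd ℝ (Fin d → ℝ) (-a₀)).trans L.toAffineEquiv
  have hψ : (fun x => L (x - a₀)) = ψ := by
    ext1 x
    simp [ψ, sub_eq_neg_add]
  have hsmall : ∀ z ∈ {z : Fin d → ℤ | ∃ a ∈ A, L (a - a₀) = intVec z}, ‖intVec z‖ ≤ D := by
    rintro z ⟨a, ha, haz⟩
    rw [← haz, pi_norm_le_iff_of_nonneg hD]
    intro j
    rw [hL]
    exact hb a ha a₀ ha₀ j
  refine ⟨⟨{z | ∃ a ∈ A, L (a - a₀) = intVec z},
    {z | ‖intVec z‖ ≤ d * D ∧ intVec z ∈ imageLattice L}⟩, hsmall, fun z hz => hz.1,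
    L, a₀, hA ha₀, hLlat, ?_, ?_, hsmall, ?_, rfl⟩
  · rw [himg, hψ]
    exact ψ.toAffineMap.image_convexHull A
  · rintro z ⟨a, ha, haz⟩
    exact mem_imageLattice.mpr ⟨a - a₀, (latticeSubgroup d).sub_mem (hA ha) (hA ha₀), haz⟩
  · change Submodule.span ℝ (intVec '' {z : Fin d → ℤ | ∃ a ∈ A, L (a - a₀) = intVec z}) = ⊤
    rw [himg, hψ, eq_top_iff]
    have h1 : affineSpan ℝ (ψ '' A) = ⊤ := (ψ.span_eq_top_iff).mp hfull
    intro x _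
    exact affineSpan_subset_span (h1 ▸ AffineSubspace.mem_top ℝ (Fin d → ℝ) x)

theorem exists_minP_dilate_eq {d : ℕ} {A : Finset (Fin d → ℝ)} (hA : A.Nonempty)
    (y : Fin d → ℝ) :
    ∃ a ∈ A, (∀ a' ∈ A, dotR a y ≤ dotR a' y) ∧
      ∀ c : ℝ, 0 ≤ c → MinP (dilate c (convexHull ℝ (A : Set (Fin d → ℝ)))) y = c * dotR a y := by
  obtain ⟨a, ha, hmin⟩ := A.exists_min_image (fun a => dotR a y) hA
  refine ⟨a, ha, hmin, fun c hc => ?_⟩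
  have hconv : ∀ x ∈ convexHull ℝ (A : Set (Fin d → ℝ)), dotR a y ≤ dotR x y := by
    refine fun x hx => convexHull_min (t := {x | dotR a y ≤ dotR x y}) hmin ?_ hx
    exact convex_halfSpace_ge ⟨fun x x' => dotR_add_left x x' y, fun c x => dotR_smul_left c x y⟩ _
  refine IsLeast.csInf_eq ⟨⟨c • a, ⟨a, subset_convexHull ℝ _ ha, rfl⟩, dotR_smul_left c a y⟩, ?_⟩
  rintro _ ⟨_, ⟨x, hx, rfl⟩, rfl⟩
  change c * dotR a y ≤ dotR (c • x) y
  rw [dotR_smul_left]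
  exact mul_le_mul_of_nonneg_left (hconv x hx) hc

theorem IsWeaklySporadic.exists_bounded_vertices {d : ℕ} {D : ℝ}
    (hD : ∀ X : Set (Fin d → ℝ), X.Finite →
      (∀ ν : Fin d → ℤ, ν ≠ 0 → ∃ a ∈ X, 1 ≤ dotR a (intVec ν)) →
      (∀ x : Fin d → ℝ, x ≠ 0 → ∃ ν : Fin d → ℤ, ν ≠ 0 ∧ ∀ a ∈ X, dotR (a + x) (intVec ν) < 1) →
      ∃ v : Fin d → Fin d → ℤ, LinearIndependent ℝ (fun j => intVec (v j)) ∧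
        ∀ a ∈ X, ∀ j, |dotR a (intVec (v j))| ≤ D)
    {P : Set (Fin d → ℝ)} (hP : IsWeaklySporadic P) :
    ∃ A : Set (Fin d → ℝ), A ⊆ latticePts d ∧ P = convexHull ℝ A ∧
      ∃ v : Fin d → Fin d → ℤ, LinearIndependent ℝ (fun j => intVec (v j)) ∧
        ∀ a ∈ A, ∀ a' ∈ A, ∀ j, |dotR (a - a') (intVec (v j))| ≤ 2 * |D| := by
  obtain ⟨⟨A, hA, rfl⟩, hfull, hhollow, p, hp⟩ := hP
  set P := convexHull ℝ (A : Set (Fin d → ℝ)) with hPdef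
  set c := minMult P with hc
  have hc0 : 0 ≤ c := Real.sInf_nonneg fun x hx => hx.1.le
  have hAne : A.Nonempty := by
    rw [← Finset.coe_nonempty, ← affineSpan_nonempty ℝ, ← affineSpan_convexHull, ← hPdef, hfull]
    exact ⟨0, trivial⟩
  have hmin := fun ν : Fin d → ℤ => exists_minP_dilate_eq hAne (intVec ν)
  have hpF : p ∈ fineInt (dilate c P) := hp ▸ mem_singleton p
  have hc1 : 1 ≤ c := by
    by_contra! hlt
    obtain ⟨a₀, ha₀⟩ := hAne
    have : p + (1 - c) • a₀ ∈ fineInt P := by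
      intro ν hν
      obtain ⟨a, ha, hle, hM⟩ := hmin ν
      have h1 := hM 1 zero_le_one
      have hd1 : dilate 1 P = P := by simp [dilate]
      rw [← hPdef, hd1, one_mul] at h1
      have h2 := hpF ν hν
      rw [hM c hc0] at h2
      rw [h1, dotR_add_left, dotR_smul_left]
      nlinarith [hle a₀ ha₀]
    rw [hhollow] at this
    exact this
  obtain ⟨v, hv, hvD⟩ := hD ((fun a => p - c • a) '' (A : Set (Fin d → ℝ)))
    (A.finite_toSet.image _) (fun ν hν => by
      obtain ⟨a, ha, -, hM⟩ := hmin ν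
      have h2 := hpF ν hν
      rw [hM c hc0] at h2
      refine ⟨_, ⟨a, ha, rfl⟩, ?_⟩
      rw [dotR_sub_left, dotR_smul_left]
      linarith) (fun x hx => by
      have hnot : p + x ∉ fineInt (dilate c P) := by
        rw [hp, mem_singleton_iff, add_eq_left]
        exact hx
      simp only [fineInt, mem_ofPred_eq, not_forall, not_le] at hnot
      obtain ⟨ν, hν, hlt⟩ := hnot
      refine ⟨ν, hν, ?_⟩
      rintro _ ⟨a', ha', rfl⟩
      obtain ⟨a, ha, hle, hM⟩ := hmin ν
      rw [hM c hc0, dotR_add_left] at hlt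
      rw [dotR_add_left, dotR_sub_left, dotR_smul_left]
      nlinarith [hle a' ha'])
  refine ⟨A, hA, rfl, v, hv, fun a ha a' ha' j => ?_⟩
  have h1 := (hvD _ ⟨a, ha, rfl⟩ j).trans (le_abs_self D)
  have h2 := (hvD _ ⟨a', ha', rfl⟩ j).trans (le_abs_self D)
  simp only [dotR_sub_left, dotR_smul_left] at h1 h2 ⊢
  have h3 : c * |dotR a (intVec (v j)) - dotR a' (intVec (v j))| ≤ 2 * |D| := by
    rw [← abs_of_nonneg hc0, ← abs_mul, abs_le]
    have h1 := abs_le.mp h1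
    have h2 := abs_le.mp h2
    constructor <;> linarith
  exact (le_mul_of_one_le_left (abs_nonneg _) hc1).trans h3

theorem exists_finite_representatives {α κ : Type*} {S : Set α} {r : α → α → Prop}
    {M : α → κ → Prop} {F : Set κ} (hF : F.Finite) (h : ∀ a ∈ S, ∃ k ∈ F, M a k)
    (hr : ∀ a b k, M a k → M b k → r a b) :
    ∃ (N : ℕ) (Q : Fin N → α), (∀ i, Q i ∈ S) ∧ ∀ a ∈ S, ∃ i, r a (Q i) := by
  have hfin : {k ∈ F | ∃ a ∈ S, M a k}.Finite := hF.subset fun k hk => hk.1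
  have := hfin.to_subtype
  obtain ⟨N, ⟨e⟩⟩ := Finite.exists_equiv_fin {k ∈ F | ∃ a ∈ S, M a k}
  choose Q hQS hQM using fun k : {k ∈ F | ∃ a ∈ S, M a k} => k.2.2
  refine ⟨N, fun i => Q (e.symm i), fun i => hQS _, fun a ha => ?_⟩
  obtain ⟨k, hk, hak⟩ := h a ha
  refine ⟨e ⟨k, hk, a, ha, hak⟩, hr a _ k hak ?_⟩
  simpa using hQM ⟨k, hk, a, ha, hak⟩

/-- In each dimension `d` there are, up to unimodular equivalence,
only finitely many `d`-dimensional weakly sporadic F-hollow lattice polytopes. -/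
theorem finitely_many_weakly_sporadic (d : ℕ) (hd : 0 < d) :
    ∃ (N : ℕ) (Qs : Fin N → Set (Fin d → ℝ)),
      (∀ i, IsLatticePolytope (Qs i) ∧ IsFullDim (Qs i)) ∧
      ∀ P : Set (Fin d → ℝ), IsWeaklySporadic P → ∃ i, UnimodEquiv P (Qs i) := by
  obtain ⟨D, hD⟩ := exists_bounded_pairing d hd
  obtain ⟨N, Q, hQ, hcover⟩ := exists_finite_representatives
    (S := {P : Set (Fin d → ℝ) | IsWeaklySporadic P}) (r := UnimodEquiv)
    (M := IsBoundedModel (2 * |D|))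
    ((finite_setOf_norm_intVec_le d (2 * |D|)).finite_subsets.prod
      (finite_setOf_norm_intVec_le d (d * (2 * |D|))).finite_subsets)
    (fun P hP => by
      obtain ⟨A, hA, rfl, v, hv, hb⟩ := IsWeaklySporadic.exists_bounded_vertices hD hP
      obtain ⟨k, hk₁, hk₂, hk⟩ := exists_isBoundedModel (by positivity) hA hP.2.1 hv hb
      exact ⟨k, ⟨hk₁, hk₂⟩, hk⟩)
    (fun _ _ _ h₁ h₂ => h₁.unimodEquiv h₂)
  exact ⟨N, Q, fun i => ⟨(hQ i).1, (hQ i).2.1⟩, hcover⟩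
end
end

section
/- For every d-dimensional rational polytope P ⊆ ℝ^d the minimal multiplier μ(P) is a rational number. -/
open Set MeasureTheory

noncomputable section

/-- Finitely many lower bounds and finitely many upper bounds that are pairwise compatible
are satisfied by a common number. -/
lemma exists_between_finsets (L U : Finset ℝ) (h : ∀ l ∈ L, ∀ u ∈ U, l ≤ u) :
    ∃ t, (∀ l ∈ L, l ≤ t) ∧ ∀ u ∈ U, t ≤ u := by
  rcases L.eq_empty_or_nonempty with rfl | hL
  · obtain ⟨t, ht⟩ := U.bddBelow
    exact ⟨t, by simp, fun u hu => ht hu⟩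
  · exact ⟨L.max' hL, fun l hl => L.le_max' l hl, fun u hu => h _ (L.max'_mem hL) u hu⟩

/-- Fourier–Motzkin elimination of one variable from a finite system of linear inequalities
with rational coefficients. -/
lemma exists_eliminate_one {E : Type*} [AddCommGroup E] [Module ℚ E] (S : Finset (ℚ × E)) :
    ∃ T : Finset E, ∀ φ : E →ₗ[ℚ] ℝ,
      (∃ t : ℝ, ∀ c ∈ S, 0 ≤ (c.1 : ℝ) * t + φ c.2) ↔ ∀ e ∈ T, 0 ≤ φ e := by
  classical
  refine ⟨(S.filter fun c => c.1 = 0).image Prod.snd ∪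
    ((S.filter fun c => 0 < c.1) ×ˢ (S.filter fun c => c.1 < 0)).image
      fun p => p.1.1 • p.2.2 - p.2.1 • p.1.2, fun φ => ⟨?_, fun h => ?_⟩⟩
  · rintro ⟨t, ht⟩ e he
    rw [Finset.mem_union, Finset.mem_image, Finset.mem_image] at he
    rcases he with ⟨c, hc, rfl⟩ | ⟨⟨p, q⟩, hpq, rfl⟩
    · rw [Finset.mem_filter] at hc
      simpa [hc.2] using ht c hc.1
    · simp only [Finset.mem_product, Finset.mem_filter] at hpq
      obtain ⟨⟨hp, hp0⟩, hq, hq0⟩ := hpq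
      have hp0' : (0 : ℝ) < p.1 := by exact_mod_cast hp0
      have hq0' : (q.1 : ℝ) < 0 := by exact_mod_cast hq0
      simp only [map_sub, map_smul, Rat.smul_def]
      nlinarith [mul_nonneg hp0'.le (ht q hq), mul_nonneg (neg_nonneg.2 hq0'.le) (ht p hp)]
  · obtain ⟨t, hl, hu⟩ := exists_between_finsets
      ((S.filter fun c => 0 < c.1).image fun c => -φ c.2 / c.1)
      ((S.filter fun c => c.1 < 0).image fun c => -φ c.2 / c.1) (by
        simp only [Finset.forall_mem_image, Finset.mem_filter]
        rintro p ⟨hp, hp0⟩ q ⟨hq, hq0⟩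
        have hp0' : (0 : ℝ) < p.1 := by exact_mod_cast hp0
        have hq0' : (q.1 : ℝ) < 0 := by exact_mod_cast hq0
        have key := h (p.1 • q.2 - q.1 • p.2) (Finset.mem_union_right _
          (Finset.mem_image.2 ⟨(p, q), by simp [hp, hq, hp0, hq0], rfl⟩))
        simp only [map_sub, map_smul, Rat.smul_def] at key
        rw [div_le_iff₀ hp0', div_mul_eq_mul_div, le_div_iff_of_neg hq0']
        linarith)
    simp only [Finset.forall_mem_image, Finset.mem_filter] at hl hu
    refine ⟨t, fun c hc => ?_⟩
    rcases lt_trichotomy c.1 0 with h0 | h0 | h0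
    · have h0' : (c.1 : ℝ) < 0 := by exact_mod_cast h0
      have := hu ⟨hc, h0⟩
      rw [le_div_iff_of_neg h0'] at this
      linarith
    · have := h c.2 (Finset.mem_union_left _
        (Finset.mem_image.2 ⟨c, by simp [hc, h0], rfl⟩))
      simpa [h0] using this
    · have h0' : (0 : ℝ) < c.1 := by exact_mod_cast h0
      have := hl ⟨hc, h0⟩
      rw [div_le_iff₀ h0'] at this
      linarith

/-- Fourier–Motzkin elimination of `n` variables from a finite system of linear inequalities
with rational coefficients. -/
lemma exists_eliminate (n : ℕ) {E : Type*} [AddCommGroup E] [Module ℚ E]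
    (S : Finset ((Fin n → ℚ) × E)) :
    ∃ T : Finset E, ∀ φ : E →ₗ[ℚ] ℝ,
      (∃ x : Fin n → ℝ, ∀ c ∈ S, 0 ≤ ∑ i, (c.1 i : ℝ) * x i + φ c.2) ↔
        ∀ e ∈ T, 0 ≤ φ e := by
  classical
  induction n with
  | zero =>
    exact ⟨S.image Prod.snd, fun φ => by simp⟩
  | succ n ih =>
    obtain ⟨T₁, hT₁⟩ := exists_eliminate_one
      (S.image fun c => (c.1 0, ((fun i : Fin n => c.1 i.succ, c.2) : (Fin n → ℚ) × E)))
    obtain ⟨T, hT⟩ := ih T₁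
    refine ⟨T, fun φ => ?_⟩
    rw [← hT φ]
    have key : ∀ y : Fin n → ℝ,
        (∃ t : ℝ, ∀ c ∈ S, 0 ≤ (c.1 0 : ℝ) * t + (∑ i, (c.1 (Fin.succ i) : ℝ) * y i + φ c.2)) ↔
          ∀ c ∈ T₁, 0 ≤ ∑ i, (c.1 i : ℝ) * y i + φ c.2 := fun y => by
      have := hT₁ (((∑ i, (LinearMap.proj i : (Fin n → ℚ) →ₗ[ℚ] ℚ).smulRight (y i)).comp
        (LinearMap.fst ℚ _ E)) + φ.comp (LinearMap.snd ℚ _ E))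
      simp only [Finset.forall_mem_image] at this
      simpa [LinearMap.sum_apply, Rat.smul_def] using this
    simp only [← key]
    constructor
    · rintro ⟨x, hx⟩
      refine ⟨fun i => x i.succ, x 0, fun c hc => ?_⟩
      have := hx c hc
      rw [Fin.sum_univ_succ] at this
      linarith
    · rintro ⟨y, t, h⟩
      refine ⟨Fin.cons t y, fun c hc => ?_⟩
      rw [Fin.sum_univ_succ]
      have := h c hc
      simp only [Fin.cons_zero, Fin.cons_succ]
      linarith

/-- The infimum of the positive solutions of a finite system of rational linear inequalities in
one variable is rational. -/
lemma exists_rat_eq_sInf (T : Finset (ℚ × ℚ)) :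
    ∃ q : ℚ, sInf {t : ℝ | 0 < t ∧ ∀ e ∈ T, 0 ≤ (e.1 : ℝ) * t + e.2} = q := by
  classical
  set Λ := {t : ℝ | 0 < t ∧ ∀ e ∈ T, 0 ≤ (e.1 : ℝ) * t + e.2}
  rcases Λ.eq_empty_or_nonempty with h | ⟨s, hs⟩
  · exact ⟨0, by simp [h]⟩
  set L : Finset ℚ := insert 0 ((T.filter fun e => 0 < e.1).image fun e => -e.2 / e.1)
  have hL : L.Nonempty := Finset.insert_nonempty _ _
  have hlow : ∀ t ∈ Λ, ((L.max' hL : ℚ) : ℝ) ≤ t := fun t ht => by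
    have : ∀ l ∈ L, (l : ℝ) ≤ t := by
      intro l hl
      rcases Finset.mem_insert.1 hl with rfl | hl
      · simpa using ht.1.le
      · obtain ⟨e, he, rfl⟩ := Finset.mem_image.1 hl
        rw [Finset.mem_filter] at he
        have h0 : (0 : ℝ) < e.1 := by exact_mod_cast he.2
        push_cast
        rw [div_le_iff₀ h0]
        linarith [ht.2 e he.1]
    exact this _ (L.max'_mem hL)
  have hmem : ∀ t : ℝ, ((L.max' hL : ℚ) : ℝ) < t → t ≤ s → t ∈ Λ := fun t ht hts => by
    have hmax : ∀ l ∈ L, (l : ℝ) < t := fun l hl =>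
      lt_of_le_of_lt (by exact_mod_cast L.le_max' l hl) ht
    refine ⟨by simpa using hmax 0 (Finset.mem_insert_self _ _), fun e he => ?_⟩
    rcases le_or_gt e.1 0 with h0 | h0
    · have h0' : (e.1 : ℝ) ≤ 0 := by exact_mod_cast h0
      nlinarith [hs.2 e he]
    · have h0' : (0 : ℝ) < e.1 := by exact_mod_cast h0
      have := hmax (-e.2 / e.1) (Finset.mem_insert_of_mem
        (Finset.mem_image.2 ⟨e, by simp [he, h0], rfl⟩))
      push_cast at this
      rw [div_lt_iff₀ h0'] at this
      linarith
  refine ⟨L.max' hL, csInf_eq_of_forall_ge_of_forall_gt_exists_lt ⟨s, hs⟩ hlow fun w hw => ?_⟩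
  rcases (hlow s hs).eq_or_lt with h | h
  · exact ⟨s, hs, h ▸ hw⟩
  · obtain ⟨t, ht, htw⟩ := exists_between (lt_min hw h)
    exact ⟨t, hmem t ht (htw.le.trans (min_le_right _ _)), htw.trans_le (min_le_left _ _)⟩

/-- A form of Gordan's lemma: given an embedding of an abelian group in `ℤ^ι`, every nonzero
element is a sum, with no cancellation in any coordinate, of elements of a fixed finite set. -/
lemma exists_finset_forall_of_add {G ι : Type*} [AddCommGroup G] [Finite ι]
    (g : G →+ (ι → ℤ)) (hg : Function.Injective g) :
    ∃ M : Finset G, (∀ m ∈ M, m ≠ 0) ∧ ∀ Q : G → Prop, (∀ m ∈ M, Q m) →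
      (∀ m n, (∀ i, 0 ≤ g m i * g n i) → Q m → Q n → Q (m + n)) → ∀ ν, ν ≠ 0 → Q ν := by
  classical
  cases nonempty_fintype ι
  let φ : G → (ι → ℕ) × (ι → ℕ) := fun ν => (fun i => (g ν i).toNat, fun i => (-g ν i).toNat)
  let S : Set ((ι → ℕ) × (ι → ℕ)) := φ '' {ν | ν ≠ 0}
  have hfin : {p | Minimal (· ∈ S) p}.Finite := by
    apply WellQuasiOrderedLE.finite_of_isAntichain
    intro a ha b hb hab hle
    exact hab (hb.eq_of_le ha.prop hle)
  choose! r hr using fun p (hp : Minimal (· ∈ S) p) => hp.prop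
  refine ⟨hfin.toFinset.image r, fun m hm => ?_, fun Q hM hadd => ?_⟩
  · obtain ⟨p, hp, rfl⟩ := Finset.mem_image.1 hm
    exact (hr p (hfin.mem_toFinset.1 hp)).1
  · suffices ∀ k : ℕ, ∀ ν, ν ≠ 0 → ∑ i, (g ν i).natAbs = k → Q ν from
      fun ν hν => this _ ν hν rfl
    intro k
    induction k using Nat.strong_induction_on with
    | _ k ih =>
    rintro ν hν rfl
    obtain ⟨p, hpν, hp⟩ := (Set.isPWO_of_wellQuasiOrderedLE S).exists_le_minimal
      (Set.mem_image_of_mem φ hν)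
    obtain ⟨hm0, hmp⟩ := hr p hp
    have hQm : Q (r p) := hM _ (Finset.mem_image_of_mem _ (hfin.mem_toFinset.2 hp))
    generalize r p = m at hm0 hmp hQm
    subst hmp
    have hle : ∀ i, (g m i).toNat ≤ (g ν i).toNat ∧ (-g m i).toNat ≤ (-g ν i).toNat :=
      fun i => ⟨hpν.1 i, hpν.2 i⟩
    by_cases hmν : ν - m = 0
    · rwa [sub_eq_zero.1 hmν]
    have hgm : g m ≠ 0 := fun h => hm0 (hg (by simpa using h))
    obtain ⟨j, hj⟩ := Function.ne_iff.1 hgm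
    have hsub : ∀ i, g (ν - m) i = g ν i - g m i := fun i => by simp
    have hQ : Q (ν - m) := by
      refine ih _ (Finset.sum_lt_sum (fun i _ => ?_) ⟨j, Finset.mem_univ _, ?_⟩) _ hmν rfl
      · have := hle i
        rw [hsub]
        omega
      · have := hle j
        rw [Pi.zero_apply] at hj
        rw [hsub]
        omega
    have := hadd m (ν - m) (fun i => ?_) hQm hQ
    · simpa using this
    · have := hle i
      rw [hsub]
      rcases lt_trichotomy (g m i) 0 with h | h | h
      · have h' : g ν i - g m i ≤ 0 := by omega
        exact mul_nonneg_of_nonpos_of_nonpos h.le h'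
      · simp [h]
      · have h' : 0 ≤ g ν i - g m i := by omega
        exact mul_nonneg h.le h'

lemma dotR_add_right {d : ℕ} (x y z : Fin d → ℝ) : dotR x (y + z) = dotR x y + dotR x z := by
  simp [dotR, mul_add, Finset.sum_add_distrib]

lemma intVec_add {d : ℕ} (m n : Fin d → ℤ) : intVec (m + n) = intVec m + intVec n := by
  ext i
  simp [intVec]

/-- The minimum of a linear functional over a dilated convex hull is attained at a dilated
generator. -/
lemma MinP_dilate_convexHull {d : ℕ} {A : Set (Fin d → ℝ)} {ν a : Fin d → ℝ} (ha : a ∈ A)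
    (hmin : ∀ b ∈ A, dotR a ν ≤ dotR b ν) {lam : ℝ} (hlam : 0 ≤ lam) :
    MinP (dilate lam (convexHull ℝ A)) ν = lam * dotR a ν := by
  have hsmul : ∀ x : Fin d → ℝ, dotR (lam • x) ν = lam * dotR x ν := fun x => by
    simp [dotR, Finset.mul_sum, mul_assoc]
  have hconv : Convex ℝ {x : Fin d → ℝ | dotR a ν ≤ dotR x ν} := by
    apply convex_halfSpace_ge
    constructor
    · intro x y
      simp [dotR, add_mul, Finset.sum_add_distrib]
    · intro c x
      simp [dotR, Finset.mul_sum, mul_assoc]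
  refine IsLeast.csInf_eq ⟨⟨lam • a, ⟨a, subset_convexHull ℝ A ha, rfl⟩, hsmul a⟩, ?_⟩
  rintro _ ⟨_, ⟨x, hx, rfl⟩, rfl⟩
  simp only [hsmul]
  exact mul_le_mul_of_nonneg_left (convexHull_min hmin hconv hx) hlam

/-- A finite family of rational points has a common denominator. -/
lemma exists_common_denominator {d : ℕ} {A : Finset (Fin d → ℝ)} (hA : ↑A ⊆ ratPts d) :
    ∃ (N : ℤ) (w : A → Fin d → ℤ), 0 < N ∧ ∀ a i, (w a i : ℝ) = N * a.1 i := by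
  choose v hv using fun (a : A) => hA a.2
  obtain ⟨b, hb⟩ := IsLocalization.exist_integer_multiples_of_finite (nonZeroDivisors ℤ)
    (fun p : A × Fin d => v p.1 p.2)
  have hb0 : (b : ℤ) ≠ 0 := nonZeroDivisors.ne_zero b.2
  choose w hw using hb
  refine ⟨b * b, fun a i => b * w (a, i), mul_self_pos.2 hb0, fun a i => ?_⟩
  have h : (w (a, i) : ℚ) = b * v a i := by simpa using hw (a, i)
  have h' : (w (a, i) : ℝ) = b * v a i := by exact_mod_cast h
  rw [hv a i]
  push_cast
  rw [h']
  ring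

/-- Finitely many of the inequalities defining the Fine interior of a dilated rational polytope
suffice, uniformly in the dilation factor. -/
lemma exists_finset_fineInt_dilate {d : ℕ} {A : Finset (Fin d → ℝ)} (hA : ↑A ⊆ ratPts d)
    (hne : A.Nonempty) :
    ∃ M : Finset (Fin d → ℤ), ∀ lam : ℝ, 0 < lam →
      fineInt (dilate lam (convexHull ℝ (A : Set (Fin d → ℝ)))) =
        {x | ∀ ν ∈ M, MinP (dilate lam (convexHull ℝ (A : Set (Fin d → ℝ)))) (intVec ν) + 1 ≤
          dotR x (intVec ν)} := by
  classical
  obtain ⟨N, w, hN, hw⟩ := exists_common_denominator hA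
  let g : (Fin d → ℤ) →+ (Fin d ⊕ A × A → ℤ) :=
    { toFun := fun ν => Sum.elim ν fun p => ∑ i, (w p.1 i - w p.2 i) * ν i
      map_zero' := by ext (i | p) <;> simp
      map_add' := fun m n => by
        ext (i | p)
        · simp
        · simp [mul_add, Finset.sum_add_distrib] }
  have hg : Function.Injective g := fun m n h => funext fun i => congrFun h (Sum.inl i)
  have hgdot : ∀ (a b : A) ν, ((g ν (Sum.inr (b, a)) : ℤ) : ℝ) =
      N * (dotR b.1 (intVec ν) - dotR a.1 (intVec ν)) := fun a b ν => by
    simp only [g, dotR, intVec, AddMonoidHom.coe_mk, ZeroHom.coe_mk, Sum.elim_inr]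
    push_cast
    rw [← Finset.sum_sub_distrib, Finset.mul_sum]
    exact Finset.sum_congr rfl fun i _ => by rw [hw, hw]; ring
  have hN' : (0 : ℝ) < N := by exact_mod_cast hN
  have hgnonneg : ∀ (a b : A) ν, 0 ≤ g ν (Sum.inr (b, a)) ↔
      dotR a.1 (intVec ν) ≤ dotR b.1 (intVec ν) := fun a b ν => by
    rw [← sub_nonneg (b := dotR a.1 (intVec ν)), ← mul_nonneg_iff_of_pos_left hN', ← hgdot]
    exact Int.cast_nonneg_iff.symm
  obtain ⟨M, hM0, hM⟩ := exists_finset_forall_of_add g hg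
  refine ⟨M, fun lam hlam => Set.Subset.antisymm (fun x hx ν hν => hx ν (hM0 ν hν))
    fun x hx => hM _ hx fun m n hmn hm hn => ?_⟩
  obtain ⟨a, ha, hmin⟩ := A.exists_min_image (fun a => dotR a (intVec (m + n))) hne
  have hboth : ∀ b ∈ A, dotR a (intVec m) ≤ dotR b (intVec m) ∧
      dotR a (intVec n) ≤ dotR b (intVec n) := fun b hb => by
    have hsum := (hgnonneg ⟨a, ha⟩ ⟨b, hb⟩ (m + n)).2 (hmin b hb)
    have hprod := hmn (Sum.inr (⟨b, hb⟩, ⟨a, ha⟩))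
    rw [map_add, Pi.add_apply] at hsum
    rw [← hgnonneg ⟨a, ha⟩ ⟨b, hb⟩ m, ← hgnonneg ⟨a, ha⟩ ⟨b, hb⟩ n]
    rcases mul_nonneg_iff.1 hprod with h | h
    · exact h
    · omega
  rw [MinP_dilate_convexHull (Finset.mem_coe.2 ha) (fun b hb => (hboth b hb).1) hlam.le] at hm
  rw [MinP_dilate_convexHull (Finset.mem_coe.2 ha) (fun b hb => (hboth b hb).2) hlam.le] at hn
  rw [MinP_dilate_convexHull (Finset.mem_coe.2 ha) (fun b hb => hmin b hb) hlam.le]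
  rw [intVec_add, dotR_add_right, dotR_add_right]
  linarith

/-- The minimal multiplier of a `d`-dimensional rational polytope
is a rational number. -/
theorem minMult_rational (d : ℕ) (hd : 0 < d) (P : Set (Fin d → ℝ))
    (hP : IsRatPolytope P) (hfull : IsFullDim P) :
    ∃ q : ℚ, minMult P = (q : ℝ) := by
  classical
  obtain ⟨A, hA, rfl⟩ := hP
  have hne : A.Nonempty := by
    rw [Finset.nonempty_iff_ne_empty]
    rintro rfl
    have : Nonempty (Fin d) := ⟨⟨0, hd⟩⟩
    simp [IsFullDim] at hfull
  obtain ⟨M, hM⟩ := exists_finset_fineInt_dilate hA hne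
  choose a haA hmin using fun ν : Fin d → ℤ =>
    A.exists_min_image (fun a => dotR a (intVec ν)) hne
  choose v hv using fun ν => hA (haA ν)
  obtain ⟨T, hT⟩ := exists_eliminate d (M.image fun ν =>
    ((fun i => (ν i : ℚ), (-∑ i, v ν i * ν i, -1)) : (Fin d → ℚ) × ℚ × ℚ))
  obtain ⟨q, hq⟩ := exists_rat_eq_sInf T
  refine ⟨q, hq ▸ congrArg sInf (Set.ext fun lam => and_congr_right fun hlam => ?_)⟩
  have hlin := hT ((LinearMap.id.smulRight lam).comp (LinearMap.fst ℚ ℚ ℚ) +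
    (LinearMap.id.smulRight (1 : ℝ)).comp (LinearMap.snd ℚ ℚ ℚ))
  simp only [LinearMap.add_apply, LinearMap.comp_apply, LinearMap.smulRight_apply,
    LinearMap.fst_apply, LinearMap.snd_apply, LinearMap.id_apply, Rat.smul_def, mul_one,
    Finset.forall_mem_image] at hlin
  rw [← hlin, hM lam hlam]
  refine exists_congr fun x => forall₂_congr fun ν _ => ?_
  rw [MinP_dilate_convexHull (Finset.mem_coe.2 (haA ν)) (fun b hb => hmin ν b hb) hlam.le]
  have h₁ : dotR (a ν) (intVec ν) = ((∑ i, v ν i * ν i : ℚ) : ℝ) := by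
    simp [dotR, intVec, hv ν]
  have h₂ : dotR x (intVec ν) = ∑ i, ((ν i : ℚ) : ℝ) * x i := by
    simp [dotR, intVec, mul_comm]
  rw [h₁, h₂]
  push_cast
  constructor <;> intro h <;> linarith
end
end
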